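/- arXiv:0712.4151 — 2 statements merged into one kernel-verified Lean document; each statement's English description precedes it below -/
import Mathlib

section
/- Every cubic graph G satisfies λ(G) ≥ ⌈v(G)/4⌉. -/
open SimpleGraph

/-- `p` encodes a 3-vertex path (a `Λ`) in `G`: three distinct vertices, the first
adjacent to the second and the second adjacent to the third. -/
def IsPathL {V : Type*} (G : SimpleGraph V) (p : V × V × V) : Prop :=
  p.1 ≠ p.2.1 ∧ p.2.1 ≠ p.2.2 ∧ p.1 ≠ p.2.2 ∧ G.Adj p.1 p.2.1 ∧ G.Adj p.2.1 p.2.2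

/-- The vertex set of an encoded 3-vertex path. -/
def pVerts {V : Type*} (p : V × V × V) : Set V := {p.1, p.2.1, p.2.2}

/-- The edge set of an encoded 3-vertex path. -/
def pEdges {V : Type*} (p : V × V × V) : Set (Sym2 V) := {s(p.1, p.2.1), s(p.2.1, p.2.2)}

/-- A `Λ`-packing of `G`: a collection of pairwise vertex-disjoint 3-vertex paths of `G`. -/
def IsPacking {V : Type*} (G : SimpleGraph V) (P : Finset (V × V × V)) : Prop :=
  (∀ p ∈ P, IsPathL G p) ∧
  ∀ p ∈ P, ∀ q ∈ P, p ≠ q → Disjoint (pVerts p) (pVerts q)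

/-- A `Λ`-factor of the induced subgraph of `G` on the vertex set `S`:
a `Λ`-packing whose paths lie in `S` and together cover all of `S`. -/
def IsFactorOn {V : Type*} (G : SimpleGraph V) (S : Set V) (P : Finset (V × V × V)) : Prop :=
  IsPacking G P ∧ (∀ p ∈ P, pVerts p ⊆ S) ∧ ∀ v ∈ S, ∃ p ∈ P, v ∈ pVerts p

/-- A `Λ`-factor of `G`. -/
def IsFactor {V : Type*} (G : SimpleGraph V) (P : Finset (V × V × V)) : Prop :=
  IsFactorOn G Set.univ P

/-- The packing `P` contains the edge `e`. -/
def PContains {V : Type*} (P : Finset (V × V × V)) (e : Sym2 V) : Prop :=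
  ∃ p ∈ P, e ∈ pEdges p

/-- `λ(G)`: the maximum number of pairwise disjoint 3-vertex paths in `G`. -/
noncomputable def lambdaNum {V : Type*} (G : SimpleGraph V) [Fintype V] : ℕ :=
  sSup {n | ∃ P : Finset (V × V × V), IsPacking G P ∧ P.card = n}

/-- Every vertex of `G` has degree exactly 3. -/
def IsCubic {V : Type*} (G : SimpleGraph V) : Prop :=
  ∀ v, (G.neighborSet v).ncard = 3

/-- `G` is `k`-connected: more than `k` vertices, and deleting any set of fewer than
`k` vertices leaves a connected graph. -/
def KConnected {V : Type*} (k : ℕ) (G : SimpleGraph V) [Fintype V] : Prop :=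
  k < Fintype.card V ∧ ∀ S : Set V, S.ncard < k → (G.induce Sᶜ).Connected

section Helpers

open scoped Classical

variable {V : Type*} {G : SimpleGraph V}

/-- The number of neighbours of `a` inside the finite set `S`. -/
noncomputable def degIn (G : SimpleGraph V) (S : Finset V) (a : V) : ℕ :=
  (S.filter (G.Adj a)).card

/-- `S` induces a connected (possibly empty) subgraph: every proper cut is crossed by an edge. -/
def CutConn (G : SimpleGraph V) (S : Finset V) : Prop :=
  ∀ A ⊆ S, A.Nonempty → (S \ A).Nonempty → ∃ a ∈ A, ∃ b ∈ S \ A, G.Adj a b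

/-- There is a packing of `k` paths inside `S`. -/
def HasPacking (G : SimpleGraph V) (S : Finset V) (k : ℕ) : Prop :=
  ∃ P : Finset (V × V × V), IsPacking G P ∧ (∀ p ∈ P, pVerts p ⊆ (S : Set V)) ∧ P.card = k

/-- `A` is joined by no edge to the rest of `S`. -/
def ClosedIn (G : SimpleGraph V) (S A : Finset V) : Prop :=
  ∀ a ∈ A, ∀ b ∈ S, G.Adj a b → b ∈ A

lemma HasPacking.zero (S : Finset V) : HasPacking G S 0 :=
  ⟨∅, ⟨by simp, by simp⟩, by simp, rfl⟩

lemma HasPacking.union {A B S : Finset V} {j k : ℕ} (hA : HasPacking G A j)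
    (hB : HasPacking G B k) (hd : Disjoint A B) (hAS : A ⊆ S) (hBS : B ⊆ S) :
    HasPacking G S (j + k) := by
  obtain ⟨P, ⟨hP1, hP2⟩, hPA, rfl⟩ := hA
  obtain ⟨Q, ⟨hQ1, hQ2⟩, hQB, rfl⟩ := hB
  have hcross : ∀ p ∈ P, ∀ q ∈ Q, Disjoint (pVerts p) (pVerts q) := fun p hp q hq =>
    Set.disjoint_of_subset (hPA p hp) (hQB q hq) (by exact_mod_cast hd)
  refine ⟨P ∪ Q, ⟨?_, ?_⟩, ?_, ?_⟩
  · intro p hp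
    rcases Finset.mem_union.1 hp with h | h
    exacts [hP1 p h, hQ1 p h]
  · intro p hp q hq hne
    rcases Finset.mem_union.1 hp with h | h <;> rcases Finset.mem_union.1 hq with h' | h'
    exacts [hP2 p h q h' hne, hcross p h q h', (hcross q h' p h).symm, hQ2 p h q h' hne]
  · intro p hp
    rcases Finset.mem_union.1 hp with h | h
    exacts [(hPA p h).trans (by exact_mod_cast hAS), (hQB p h).trans (by exact_mod_cast hBS)]
  · refine Finset.card_union_of_disjoint (Finset.disjoint_left.2 fun p hp hq => ?_)
    have h1 : p.1 ∈ pVerts p := by simp [pVerts]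
    exact Set.disjoint_left.1 (hcross p hp p hq) h1 h1

lemma HasPacking.one {A : Finset V} {x y z : V} (hx : x ∈ A) (hy : y ∈ A) (hz : z ∈ A)
    (hxz : x ≠ z) (hxy : G.Adj x y) (hyz : G.Adj y z) : HasPacking G A 1 := by
  refine ⟨{(x, y, z)}, ⟨?_, ?_⟩, ?_, by simp⟩
  · simp only [Finset.mem_singleton, forall_eq]
    exact ⟨hxy.ne, hyz.ne, hxz, hxy, hyz⟩
  · simp
  · simp only [Finset.mem_singleton, forall_eq, pVerts]
    rintro w (rfl | rfl | rfl) <;> assumption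

lemma degIn_split {S A : Finset V} (h : A ⊆ S) (a : V) :
    degIn G S a = degIn G (S \ A) a + degIn G A a := by
  unfold degIn
  rw [← Finset.card_union_of_disjoint
    (Finset.disjoint_filter_filter Finset.sdiff_disjoint), ← Finset.filter_union,
    Finset.sdiff_union_of_subset h]

lemma sum_degIn_comm (A B : Finset V) : ∑ a ∈ A, degIn G B a = ∑ b ∈ B, degIn G A b := by
  simp only [degIn, Finset.card_filter]
  rw [Finset.sum_comm]
  simp only [G.adj_comm]

lemma sum_degIn_remove {S A : Finset V} (h : A ⊆ S) :
    ∑ a ∈ S, degIn G S a =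
      ∑ a ∈ S \ A, degIn G (S \ A) a + ∑ a ∈ A, (degIn G S a + degIn G (S \ A) a) := by
  rw [← Finset.sum_sdiff h, Finset.sum_congr rfl (fun a _ => degIn_split h a),
    Finset.sum_add_distrib, Finset.sum_add_distrib, sum_degIn_comm (S \ A) A]
  ring

lemma even_sum_degIn (S : Finset V) : Even (∑ a ∈ S, degIn G S a) := by
  induction S using Finset.induction_on with
  | empty => simp
  | insert x S hx ih =>
    have hsub : {x} ⊆ insert x S := by simp
    have hsd : insert x S \ {x} = S := by
      rw [Finset.sdiff_singleton_eq_erase, Finset.erase_insert hx]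
    have hxx : degIn G (insert x S) x = degIn G S x := by
      have := degIn_split (G := G) hsub x
      rw [hsd] at this
      rwa [show degIn G {x} x = 0 by simp [degIn, Finset.filter_singleton], add_zero] at this
    rw [sum_degIn_remove hsub, hsd, Finset.sum_singleton, hxx]
    exact ih.add ⟨_, rfl⟩

lemma degIn_mono {A B : Finset V} (h : A ⊆ B) (a : V) : degIn G A a ≤ degIn G B a :=
  Finset.card_le_card (Finset.filter_subset_filter _ h)

lemma degIn_le_card {S B : Finset V} {a : V} (h : ∀ b ∈ S, G.Adj a b → b ∈ B) :
    degIn G S a ≤ B.card :=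
  Finset.card_le_card fun b hb => h b (Finset.mem_filter.1 hb).1 (Finset.mem_filter.1 hb).2

lemma degIn_add_card_le (h3 : ∀ S a, degIn G S a ≤ 3) {S B : Finset V} {a : V}
    (hB : ∀ b ∈ B, G.Adj a b) (hd : Disjoint S B) : degIn G S a + B.card ≤ 3 := by
  have h1 := degIn_split (G := G) (Finset.subset_union_right (s₁ := S) (s₂ := B)) a
  rw [Finset.union_sdiff_cancel_right hd] at h1
  have h2 : degIn G B a = B.card := by
    unfold degIn
    rw [Finset.filter_true_of_mem hB]
  rw [← h2, ← h1]
  exact h3 _ _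

lemma ClosedIn.sdiff {S A : Finset V} (h : ClosedIn G S A) :
    ClosedIn G S (S \ A) := by
  intro a ha b hb hab
  rw [Finset.mem_sdiff] at ha ⊢
  exact ⟨hb, fun hbA => ha.2 (h b hbA a ha.1 hab.symm)⟩

lemma CutConn.eq_of_closedIn {S A : Finset V} (h : CutConn G S) (hA : A ⊆ S)
    (hne : A.Nonempty) (hc : ClosedIn G S A) : A = S := by
  by_contra hAS
  have h2 : (S \ A).Nonempty := by
    rw [Finset.sdiff_nonempty]
    exact fun h' => hAS (hA.antisymm h')
  obtain ⟨a, ha, b, hb, hab⟩ := h A hA hne h2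
  rw [Finset.mem_sdiff] at hb
  exact hb.2 (hc a ha b hb.1 hab)

lemma cutConn_of_closedIn {S : Finset V}
    (h : ∀ A ⊆ S, A.Nonempty → ClosedIn G S A → A = S) : CutConn G S := by
  intro A hA hne h2
  by_contra hcon
  push Not at hcon
  have : A = S := h A hA hne fun a ha b hb hab => by
    by_contra hbA
    exact hcon a ha b (Finset.mem_sdiff.2 ⟨hb, hbA⟩) hab
  simp [this] at h2

lemma cutConn_of_closedIn_mem {S : Finset V} {v : V} (hv : v ∈ S)
    (h : ∀ A ⊆ S, v ∈ A → ClosedIn G S A → A = S) : CutConn G S := by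
  refine cutConn_of_closedIn fun A hA hne hc => ?_
  by_cases hvA : v ∈ A
  · exact h A hA hvA hc
  · have := h (S \ A) Finset.sdiff_subset (Finset.mem_sdiff.2 ⟨hv, hvA⟩) hc.sdiff
    obtain ⟨a, ha⟩ := hne
    have h3 := hA ha
    rw [← this] at h3
    exact absurd ha (Finset.mem_sdiff.1 h3).2

lemma ClosedIn.inter {S A B : Finset V} (h : ClosedIn G S A) (hB : B ⊆ S) :
    ClosedIn G B (A ∩ B) := by
  intro a ha b hb hab
  rw [Finset.mem_inter] at ha ⊢
  exact ⟨h a ha.1 b (hB hb) hab, hb⟩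

lemma CutConn.union {A B : Finset V} (hA : CutConn G A) (hB : CutConn G B) {a b : V}
    (ha : a ∈ A) (hb : b ∈ B) (hab : G.Adj a b) : CutConn G (A ∪ B) := by
  refine cutConn_of_closedIn_mem (v := a) (Finset.mem_union_left _ ha) fun X hX haX hc => ?_
  have hbX : b ∈ X := hc a haX b (Finset.mem_union_right _ hb) hab
  have h1 := hA.eq_of_closedIn Finset.inter_subset_right ⟨a, Finset.mem_inter.2 ⟨haX, ha⟩⟩
    (hc.inter Finset.subset_union_left)
  have h2 := hB.eq_of_closedIn Finset.inter_subset_right ⟨b, Finset.mem_inter.2 ⟨hbX, hb⟩⟩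
    (hc.inter Finset.subset_union_right)
  refine hX.antisymm (Finset.union_subset ?_ ?_)
  · exact Finset.inter_eq_right.1 h1
  · exact Finset.inter_eq_right.1 h2

lemma cutConn_singleton (v : V) : CutConn G {v} :=
  cutConn_of_closedIn fun _ hA hne _ => (Finset.subset_singleton_iff.1 hA).resolve_left
    hne.ne_empty

/-- Every vertex of `S` lies in a connected component of `S`. -/
lemma exists_component {S : Finset V} {w : V} (hw : w ∈ S) :
    ∃ C ⊆ S, w ∈ C ∧ ClosedIn G S C ∧ CutConn G C := by
  obtain ⟨C, hC, hmin⟩ := Finset.exists_min_image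
    (S.powerset.filter fun C => w ∈ C ∧ ClosedIn G S C) Finset.card
    ⟨S, by simp only [Finset.mem_filter, Finset.mem_powerset]
           exact ⟨subset_rfl, hw, fun _ _ b hb _ => hb⟩⟩
  simp only [Finset.mem_filter, Finset.mem_powerset] at hC hmin
  refine ⟨C, hC.1, hC.2.1, hC.2.2, cutConn_of_closedIn_mem hC.2.1 fun A hA hwA hc => ?_⟩
  refine Finset.eq_of_subset_of_card_le hA (hmin A ⟨hA.trans hC.1, hwA, ?_⟩)
  exact fun a ha b hb hab => hc a ha b (hC.2.2 a (hA ha) b hb hab) hab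

/-- A connected set with at least three vertices has a pendant connected part `T`, attached to
the rest at `v`, such that all components of `T - v` have at most two vertices. -/
lemma exists_pendant {S : Finset V} (hS : CutConn G S) (hcard : 3 ≤ S.card) :
    ∃ T ⊆ S, ∃ v ∈ T, 3 ≤ T.card ∧ CutConn G (S \ T) ∧
      (S = T ∨ ∃ p ∈ S \ T, G.Adj v p) ∧
      (∀ w ∈ T.erase v, ∀ x ∈ T.erase v, ∀ y ∈ T.erase v, G.Adj w x → G.Adj w y → x = y) ∧
      (∀ w ∈ T.erase v, G.Adj v w ∨ ∃ c ∈ T.erase v, G.Adj c w ∧ G.Adj v c) := by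
  obtain ⟨s, hs⟩ : S.Nonempty := Finset.card_pos.1 (by omega)
  obtain ⟨T, hT, hmin⟩ := Finset.exists_min_image
    (S.powerset.filter fun T => 3 ≤ T.card ∧ CutConn G T ∧ CutConn G (S \ T) ∧
      ∃ v ∈ T, S = T ∨ ∃ p ∈ S \ T, G.Adj v p) Finset.card
    ⟨S, by simp only [Finset.mem_filter, Finset.mem_powerset]
           refine ⟨subset_rfl, hcard, hS, ?_, s, hs, Or.inl trivial⟩
           intro A hA hne
           simp only [Finset.sdiff_self, Finset.subset_empty] at hA
           simp [hA] at hne⟩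
  simp only [Finset.mem_filter, Finset.mem_powerset] at hT hmin
  obtain ⟨hTS, hT3, hTc, hSTc, v, hv, hout⟩ := hT
  have key : ∀ w ∈ T.erase v, ∃ C ⊆ T.erase v, w ∈ C ∧ ClosedIn G (T.erase v) C ∧
      CutConn G C ∧ C.card ≤ 2 ∧ ∃ c ∈ C, G.Adj v c := by
    intro w hw
    obtain ⟨C, hCT, hwC, hcl, hCc⟩ := exists_component (G := G) hw
    have hCT' : C ⊆ T := hCT.trans (Finset.erase_subset _ _)
    have hvC : v ∉ C := fun h => by simpa using hCT h
    obtain ⟨c, hc, b, hb, hcb⟩ := hTc C hCT' ⟨w, hwC⟩ ⟨v, Finset.mem_sdiff.2 ⟨hv, hvC⟩⟩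
    rw [Finset.mem_sdiff] at hb
    obtain rfl : b = v := by
      by_contra hbv
      exact hb.2 (hcl c hc b (Finset.mem_erase.2 ⟨hbv, hb.1⟩) hcb)
    refine ⟨C, hCT, hwC, hcl, hCc, ?_, c, hc, hcb.symm⟩
    by_contra hC2
    have hrest : CutConn G (T \ C) := by
      refine cutConn_of_closedIn_mem (Finset.mem_sdiff.2 ⟨hv, hvC⟩) fun A hA hbA hAc => ?_
      have : A ∪ C = T := by
        refine hTc.eq_of_closedIn (Finset.union_subset (hA.trans Finset.sdiff_subset) hCT')
          ⟨b, Finset.mem_union_left _ hbA⟩ ?_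
        intro a ha d hd had
        rw [Finset.mem_union] at ha ⊢
        by_cases hdC : d ∈ C
        · exact Or.inr hdC
        rcases ha with ha | ha
        · exact Or.inl (hAc a ha d (Finset.mem_sdiff.2 ⟨hd, hdC⟩) had)
        · by_cases hdb : d = b
          · exact Or.inl (hdb ▸ hbA)
          · exact Or.inr (hcl a ha d (Finset.mem_erase.2 ⟨hdb, hd⟩) had)
      refine hA.antisymm fun d hd => ?_
      rw [Finset.mem_sdiff, ← this, Finset.mem_union] at hd
      exact hd.1.resolve_right hd.2
    have hSC : CutConn G (S \ C) := by
      rcases hout with rfl | ⟨p, hp, hvp⟩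
      · exact hrest
      · have := hSTc.union hrest hp (Finset.mem_sdiff.2 ⟨hv, hvC⟩) hvp.symm
        convert this using 1
        ext d
        have := @hTS d
        have := @hCT' d
        simp only [Finset.mem_sdiff, Finset.mem_union]
        tauto
    have hle := hmin C ⟨hCT'.trans hTS, by omega, hCc, hSC, c, hc,
      Or.inr ⟨b, Finset.mem_sdiff.2 ⟨hTS hv, hvC⟩, hcb⟩⟩
    exact hvC (Finset.eq_of_subset_of_card_le hCT' hle ▸ hv)
  refine ⟨T, hTS, v, hv, hT3, hSTc, hout, ?_, ?_⟩
  · intro w hw x hx y hy hwx hwy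
    obtain ⟨C, hCT, hwC, hcl, hCc, hC2, -⟩ := key w hw
    have hxC := hcl w hwC x hx hwx
    have hyC := hcl w hwC y hy hwy
    by_contra hxy
    have : ({w, x, y} : Finset V) ⊆ C := by
      simp [Finset.insert_subset_iff, hwC, hxC, hyC]
    have := Finset.card_le_card this
    rw [Finset.card_eq_three.2 ⟨w, x, y, hwx.ne, hwy.ne, hxy, rfl⟩] at this
    omega
  · intro w hw
    obtain ⟨C, hCT, hwC, hcl, hCc, hC2, c, hc, hvc⟩ := key w hw
    by_cases hcw : c = w
    · exact Or.inl (hcw ▸ hvc)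
    · refine Or.inr ⟨c, hCT hc, ?_, hvc⟩
      obtain ⟨a, ha, d, hd, had⟩ := hCc {w} (by simpa using hwC) ⟨w, by simp⟩
        ⟨c, by simp [hc, hcw]⟩
      rw [Finset.mem_singleton] at ha
      rw [Finset.mem_sdiff, Finset.mem_singleton] at hd
      obtain rfl : d = c := by
        by_contra hdc
        have : ({w, c, d} : Finset V) ⊆ C := by
          simp [Finset.insert_subset_iff, hwC, hc, hd.1]
        have := Finset.card_le_card this
        rw [Finset.card_eq_three.2 ⟨w, c, d, Ne.symm hcw, Ne.symm hd.2, Ne.symm hdc, rfl⟩] at this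
        omega
      exact ha ▸ had.symm

/-- `S` has a packing whose size is bounded below by `(|S| + e(S) - 3) / 10`. -/
def GoodPacking (G : SimpleGraph V) (S : Finset V) : Prop :=
  ∃ k, HasPacking G S k ∧ 2 * S.card + ∑ a ∈ S, degIn G S a ≤ 20 * k + 6

lemma GoodPacking.of_sdiff {S A : Finset V} (h : GoodPacking G (S \ A)) (hA : A ⊆ S)
    (hp : HasPacking G A 1)
    (hw : 2 * A.card + ∑ a ∈ A, (degIn G S a + degIn G (S \ A) a) ≤ 20) :
    GoodPacking G S := by
  obtain ⟨k, hk, hle⟩ := h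
  refine ⟨k + 1, hk.union hp Finset.sdiff_disjoint Finset.sdiff_subset hA, ?_⟩
  rw [sum_degIn_remove hA]
  have := Finset.card_sdiff_add_card_eq_card hA
  omega

lemma GoodPacking.of_sdiff_path (h3 : ∀ S a, degIn G S a ≤ 3) {S : Finset V} {x y z : V}
    (h : GoodPacking G (S \ {x, y, z})) (hx : x ∈ S) (hy : y ∈ S) (hz : z ∈ S)
    (hxz : x ≠ z) (hxy : G.Adj x y) (hyz : G.Adj y z) : GoodPacking G S := by
  have hsub : ({x, y, z} : Finset V) ⊆ S := by simp [Finset.insert_subset_iff, hx, hy, hz]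
  refine h.of_sdiff hsub
    (HasPacking.one (x := x) (y := y) (z := z) (by simp) (by simp) (by simp) hxz hxy hyz) ?_
  have ex := degIn_add_card_le h3 (S := S \ {x, y, z}) (B := {y}) (a := x)
    (by simpa using hxy) (by simp)
  have ey := degIn_add_card_le h3 (S := S \ {x, y, z}) (B := {x, z}) (a := y)
    (by simpa using ⟨hxy.symm, hyz⟩)
    (Finset.disjoint_left.2 fun w hw => by
      simp only [Finset.mem_sdiff, Finset.mem_insert, Finset.mem_singleton] at hw ⊢
      tauto)
  have ez := degIn_add_card_le h3 (S := S \ {x, y, z}) (B := {y}) (a := z)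
    (by simpa using hyz.symm) (by simp)
  rw [Finset.card_singleton] at ex ez
  rw [Finset.card_pair hxz] at ey
  rw [Finset.card_eq_three.2 ⟨x, y, z, hxy.ne, hxz, hyz.ne, rfl⟩,
    Finset.sum_insert (by simp [hxy.ne, hxz]), Finset.sum_pair hyz.ne]
  have := h3 S x
  have := h3 S y
  have := h3 S z
  omega

lemma degIn_le_one {S : Finset V} {a : V}
    (h : ∀ x ∈ S, ∀ y ∈ S, G.Adj a x → G.Adj a y → x = y) : degIn G S a ≤ 1 := by
  refine Finset.card_le_one.2 fun x hx y hy => ?_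
  rw [Finset.mem_filter] at hx hy
  exact h x hx.1 y hy.1 hx.2 hy.2

lemma goodPacking_of_card_le_two {S : Finset V} (h : S.card ≤ 2) : GoodPacking G S := by
  refine ⟨0, HasPacking.zero S, ?_⟩
  have hle : ∑ a ∈ S, degIn G S a ≤ S.card • (S.card - 1) := by
    refine Finset.sum_le_card_nsmul _ _ _ fun a ha => ?_
    rw [← Finset.card_erase_of_mem ha]
    exact degIn_le_card fun b hb hab => Finset.mem_erase.2 ⟨hab.ne', hb⟩
  rw [smul_eq_mul] at hle
  interval_cases S.card <;> omega

/-- A connected set in a subcubic graph has a packing of size at least `(|S| + e(S) - 3) / 10`. -/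
lemma goodPacking_of_cutConn (h3 : ∀ S a, degIn G S a ≤ 3) (S : Finset V) (hS : CutConn G S) :
    GoodPacking G S := by
  induction S using Finset.strongInduction with
  | H S ih =>
  rcases Nat.lt_or_ge S.card 3 with hlt | hge
  · exact goodPacking_of_card_le_two (by omega)
  obtain ⟨T, hTS, v, hv, hT3, hrest, hout, huniq, hdist⟩ := exists_pendant hS hge
  set N := T.filter (G.Adj v) with hN
  set M := (T.erase v).filter (fun w => ¬ G.Adj v w) with hM
  have hNT : N = (T.erase v).filter (G.Adj v) := by
    ext w
    simp only [hN, Finset.mem_filter, Finset.mem_erase]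
    exact ⟨fun h => ⟨⟨h.2.ne', h.1⟩, h.2⟩, fun h => ⟨h.1.2, h.2⟩⟩
  have hNM : N ∪ M = T.erase v := by
    rw [hNT, hM, Finset.filter_union_filter_not_eq]
  have hdisj : Disjoint N M := by
    rw [hNT, hM]
    exact Finset.disjoint_filter_filter_not _ _ _
  have hcard : N.card + M.card + 1 = T.card := by
    rw [← Finset.card_union_of_disjoint hdisj, hNM, Finset.card_erase_add_one hv]
  have hTeq : T = insert v (N ∪ M) := by rw [hNM, Finset.insert_erase hv]
  have hvNM : v ∉ N ∪ M := by simp [hNM]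
  have hdegv : degIn G T v = N.card := rfl
  have hMnbr : ∀ m ∈ M, ∃ c ∈ N, G.Adj c m := by
    intro m hm
    obtain ⟨hmT, hmv⟩ := Finset.mem_filter.1 hm
    obtain ⟨c, hc, hcm, hvc⟩ := (hdist m hmT).resolve_left hmv
    exact ⟨c, Finset.mem_filter.2 ⟨Finset.mem_of_mem_erase hc, hvc⟩, hcm⟩
  have hMT : ∀ m ∈ M, m ∈ T.erase v := fun m hm => (Finset.mem_filter.1 hm).1
  have hNT' : ∀ c ∈ N, c ∈ T.erase v := fun c hc => (Finset.mem_filter.1 (hNT ▸ hc)).1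
  have hMN : M.card ≤ N.card := by
    choose! f hf hfm using hMnbr
    refine Finset.card_le_card_of_injOn f hf fun m hm m' hm' heq => ?_
    exact huniq (f m) (hNT' _ (hf m hm)) m (hMT m hm) m' (hMT m' hm') (hfm m hm)
      (heq ▸ hfm m' hm')
  have hsplit : ∀ w, degIn G T w = degIn G (T.erase v) w + degIn G {v} w := by
    intro w
    rw [degIn_split (Finset.singleton_subset_iff.2 hv) w, Finset.sdiff_singleton_eq_erase]
  have hdegN : ∀ c ∈ N, degIn G T c ≤ 2 := by
    intro c hc
    have h1 := degIn_le_one (huniq c (hNT' c hc))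
    have h2 : degIn G {v} c ≤ 1 := Finset.card_filter_le _ _
    have := hsplit c
    omega
  have hdegM : ∀ m ∈ M, degIn G T m ≤ 1 := by
    intro m hm
    have h1 := degIn_le_one (huniq m (hMT m hm))
    have h2 : degIn G {v} m = 0 := by
      have : ¬ G.Adj m v := fun h => (Finset.mem_filter.1 hm).2 h.symm
      simp [degIn, Finset.filter_singleton, this]
    have := hsplit m
    omega
  have hNadj : ∀ c ∈ N, G.Adj v c := fun c hc => (Finset.mem_filter.1 hc).2
  have hne : ∀ w ∈ T.erase v, w ≠ v := fun w hw => Finset.ne_of_mem_erase hw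
  have hmemT : ∀ w ∈ T.erase v, w ∈ T := fun w hw => Finset.mem_of_mem_erase hw
  rcases hout with rfl | ⟨p, hp, hvp⟩
  · have hpath : HasPacking G S 1 := by
      rcases M.eq_empty_or_nonempty with h0 | ⟨m, hm⟩
      · rw [h0, Finset.card_empty] at hcard
        obtain ⟨c, hc, d, hd, hcd⟩ := Finset.one_lt_card.1 (show 1 < N.card by omega)
        exact HasPacking.one (hmemT _ (hNT' c hc)) hv (hmemT _ (hNT' d hd)) hcd
          (hNadj c hc).symm (hNadj d hd)
      · obtain ⟨c, hc, hcm⟩ := hMnbr m hm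
        exact HasPacking.one hv (hmemT _ (hNT' c hc)) (hmemT _ (hMT m hm))
          (hne m (hMT m hm)).symm (hNadj c hc) hcm
    refine ⟨1, hpath, ?_⟩
    have hsum : ∑ a ∈ S, degIn G S a
        = degIn G S v + (∑ a ∈ N, degIn G S a + ∑ a ∈ M, degIn G S a) := by
      rw [← Finset.sum_union hdisj, ← Finset.sum_insert hvNM, ← hTeq]
    have hsN : ∑ a ∈ N, degIn G S a ≤ N.card • 2 := Finset.sum_le_card_nsmul N _ _ hdegN
    have hsM : ∑ a ∈ M, degIn G S a ≤ M.card • 1 := Finset.sum_le_card_nsmul M _ _ hdegM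
    have := h3 S v
    rw [smul_eq_mul] at hsN hsM
    omega
  have hN2 : N.card ≤ 2 := by
    have := degIn_add_card_le h3 (S := T) (B := {p}) (a := v) (by simpa using hvp)
      (by simpa using (Finset.mem_sdiff.1 hp).2)
    rw [Finset.card_singleton] at this
    omega
  have hvS := hTS hv
  have ih' : ∀ A : Finset V, v ∈ A → CutConn G (S \ A) → GoodPacking G (S \ A) := by
    intro A hA hc
    refine ih _ (Finset.ssubset_iff_subset_ne.2 ⟨Finset.sdiff_subset, fun h => ?_⟩) hc
    rw [← h] at hvS
    exact (Finset.mem_sdiff.1 hvS).2 hA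
  have ihC : ∀ A C : Finset V, v ∈ A → A ∪ C = T → Disjoint A C → CutConn G C →
      ∀ c ∈ C, ∀ b ∈ S \ T, G.Adj c b → GoodPacking G (S \ A) := by
    intro A C hvA hAC hd hC c hc b hb hcb
    refine ih' A hvA ?_
    have hCS : C ⊆ S := (hAC ▸ Finset.subset_union_right).trans hTS
    have := hC.union hrest hc hb hcb
    convert this using 1
    ext w
    have h1 := @hCS w
    have h2 := @Finset.disjoint_left _ A C |>.1 hd
    simp only [← hAC, Finset.mem_sdiff, Finset.mem_union]
    tauto
  have ihT : ∀ A : Finset V, v ∈ A → A = T → GoodPacking G (S \ A) := by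
    rintro A hA rfl
    exact ih' A hA hrest
  have hdegS : ∀ w, degIn G S w = degIn G (S \ T) w + degIn G T w := degIn_split hTS
  have hzero : ∀ w, (∀ b ∈ S \ T, ¬ G.Adj w b) → degIn G (S \ T) w = 0 := by
    intro w hw
    simpa [degIn, Finset.filter_eq_empty_iff] using hw
  have hv1 : degIn G (S \ T) v + N.card ≤ 3 :=
    degIn_add_card_le h3 hNadj
      (Finset.disjoint_left.2 fun w hw hwN => (Finset.mem_sdiff.1 hw).2 (hmemT _ (hNT' w hwN)))
  rcases M.eq_empty_or_nonempty with h0 | ⟨g₁, hg₁⟩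
  · rw [h0, Finset.card_empty] at hcard
    obtain ⟨c, d, hcd, hNcd⟩ := Finset.card_eq_two.1 (show N.card = 2 by omega)
    have hc : c ∈ N := by simp [hNcd]
    have hd : d ∈ N := by simp [hNcd]
    refine GoodPacking.of_sdiff_path h3 (ihT {c, v, d} (by simp) ?_) (hTS (hmemT _ (hNT' c hc)))
      hvS (hTS (hmemT _ (hNT' d hd))) hcd (hNadj c hc).symm (hNadj d hd)
    rw [hTeq, hNcd, h0, Finset.union_empty, Finset.insert_comm]
  obtain ⟨c₁, hc₁, hcg₁⟩ := hMnbr g₁ hg₁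
  have hM1 : 1 ≤ M.card := Finset.card_pos.2 ⟨g₁, hg₁⟩
  have hc₁S := hTS (hmemT _ (hNT' c₁ hc₁))
  have hg₁S := hTS (hmemT _ (hMT g₁ hg₁))
  have hvc₁ := hNadj c₁ hc₁
  have hvg₁ := (hne g₁ (hMT g₁ hg₁)).symm
  rcases Nat.lt_or_ge N.card 2 with hN1 | hN1
  · obtain ⟨c, hNc⟩ := Finset.card_eq_one.1 (show N.card = 1 by omega)
    obtain ⟨g, hMg⟩ := Finset.card_eq_one.1 (show M.card = 1 by omega)
    obtain rfl : c₁ = c := by simpa [hNc] using hc₁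
    obtain rfl : g₁ = g := by simpa [hMg] using hg₁
    refine GoodPacking.of_sdiff_path h3 (ihT {v, c₁, g₁} (by simp) ?_) hvS hc₁S hg₁S
      hvg₁ hvc₁ hcg₁
    rw [hTeq, hNc, hMg]
    rfl
  obtain ⟨c₂, hc₂, hc₂₁⟩ := Finset.exists_mem_ne (show 1 < N.card by omega) c₁
  have hNeq : N = {c₁, c₂} := (Finset.eq_of_subset_of_card_le
    (by simp [Finset.insert_subset_iff, hc₁, hc₂])
    (by rw [Finset.card_pair hc₂₁.symm]; exact hN2)).symm
  have hc₂S := hTS (hmemT _ (hNT' c₂ hc₂))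
  have hvc₂ := hNadj c₂ hc₂
  have hcg : ∀ c ∈ N, ∀ g ∈ M, c ≠ g := fun c hc g hg h =>
    Finset.disjoint_left.1 hdisj hc (h ▸ hg)
  have hc₁g₁ := hcg c₁ hc₁ g₁ hg₁
  have hc₂g₁ := hcg c₂ hc₂ g₁ hg₁
  have hvc₁' := hvc₁.ne
  have hvc₂' := hvc₂.ne
  have dv : degIn G (S \ T) v ≤ 1 := by omega
  have dc₁ := hdegN c₁ hc₁
  have dc₂ := hdegN c₂ hc₂
  have dg₁ := hdegM g₁ hg₁
  have sv := hdegS v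
  have sc₁ := hdegS c₁
  have sc₂ := hdegS c₂
  have sg₁ := hdegS g₁
  have hpT : HasPacking G T 1 := HasPacking.one (hmemT _ (hNT' c₁ hc₁)) hv
    (hmemT _ (hNT' c₂ hc₂)) hc₂₁.symm hvc₁.symm hvc₂
  rcases Nat.lt_or_ge M.card 2 with hM2 | hM2
  · obtain ⟨g, hMg⟩ := Finset.card_eq_one.1 (show M.card = 1 by omega)
    obtain rfl : g₁ = g := by simpa [hMg] using hg₁
    have hT4 : T = {v, c₁, c₂, g₁} := by
      rw [hTeq, hNeq, hMg, Finset.insert_union, Finset.singleton_union]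
    by_cases hx : ∃ b ∈ S \ T, G.Adj c₂ b
    · obtain ⟨b, hb, hcb⟩ := hx
      refine GoodPacking.of_sdiff_path h3 (ihC {v, c₁, g₁} {c₂} (by simp) ?_ ?_
        (cutConn_singleton _) c₂ (by simp) b hb hcb) hvS hc₁S hg₁S hvg₁ hvc₁ hcg₁
      · rw [hT4]
        ext w
        simp only [Finset.mem_union, Finset.mem_insert, Finset.mem_singleton]
        clear * -
        tauto
      · simp [hvc₂'.symm, hc₂₁, hc₂g₁]
    by_cases hy : ∃ b ∈ S \ T, G.Adj g₁ b
    · obtain ⟨b, hb, hgb⟩ := hy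
      refine GoodPacking.of_sdiff_path h3 (ihC {c₁, v, c₂} {g₁} (by simp) ?_ ?_
        (cutConn_singleton _) g₁ (by simp) b hb hgb) hc₁S hvS hc₂S hc₂₁.symm hvc₁.symm hvc₂
      · rw [hT4]
        ext w
        simp only [Finset.mem_union, Finset.mem_insert, Finset.mem_singleton]
        clear * -
        tauto
      · simp [hvg₁.symm, hc₁g₁.symm, hc₂g₁.symm]
    push Not at hx hy
    have zc₂ := hzero c₂ hx
    have zg₁ := hzero g₁ hy
    have wc₁ : degIn G (S \ T) c₁ + ({v, g₁} : Finset V).card ≤ 3 := by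
      refine degIn_add_card_le h3 (by simpa using ⟨hvc₁.symm, hcg₁⟩)
        (Finset.disjoint_left.2 fun w hw => ?_)
      simp only [hT4, Finset.mem_sdiff, Finset.mem_insert, Finset.mem_singleton] at hw ⊢
      tauto
    rw [Finset.card_pair hvg₁] at wc₁
    refine (ih' T hv hrest).of_sdiff hTS hpT ?_
    have hsum : ∀ f : V → ℕ, ∑ a ∈ T, f a = f v + (f c₁ + (f c₂ + f g₁)) := by
      intro f
      rw [hT4, Finset.sum_insert (by simp [hvc₁', hvc₂', hvg₁]),
        Finset.sum_insert (by simp [hc₂₁.symm, hc₁g₁]), Finset.sum_pair hc₂g₁]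
    rw [hsum]
    omega
  · obtain ⟨g₂, hg₂, hg₂₁⟩ := Finset.exists_mem_ne (show 1 < M.card by omega) g₁
    have hMeq : M = {g₁, g₂} := (Finset.eq_of_subset_of_card_le
      (by simp [Finset.insert_subset_iff, hg₁, hg₂])
      (by rw [Finset.card_pair hg₂₁.symm]; omega)).symm
    obtain ⟨c, hc, hcg₂⟩ := hMnbr g₂ hg₂
    obtain rfl : c = c₂ := by
      rw [hNeq, Finset.mem_insert, Finset.mem_singleton] at hc
      refine hc.resolve_left fun h => hg₂₁ ?_
      exact huniq c₁ (hNT' _ hc₁) g₂ (hMT _ hg₂) g₁ (hMT _ hg₁) (h ▸ hcg₂) hcg₁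
    have hg₂S := hTS (hmemT _ (hMT g₂ hg₂))
    have hvg₂ := (hne g₂ (hMT g₂ hg₂)).symm
    have hc₁g₂ := hcg c₁ hc₁ g₂ hg₂
    have hc₂g₂ := hcg c hc g₂ hg₂
    have dg₂ := hdegM g₂ hg₂
    have sg₂ := hdegS g₂
    have hT5 : T = {v, c₁, c, g₁, g₂} := by
      rw [hTeq, hNeq, hMeq, Finset.insert_union, Finset.singleton_union]
    by_cases hx : ∃ a ∈ ({c₁, g₁} : Finset V), ∃ b ∈ S \ T, G.Adj a b
    · obtain ⟨a, ha, b, hb, hab⟩ := hx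
      refine GoodPacking.of_sdiff_path h3 (ihC {v, c, g₂} {c₁, g₁} (by simp) ?_ ?_
        ((cutConn_singleton c₁).union (cutConn_singleton g₁) (by simp) (by simp) hcg₁)
        a ha b hb hab) hvS hc₂S hg₂S hvg₂ hvc₂ hcg₂
      · rw [hT5]
        ext w
        simp only [Finset.mem_union, Finset.mem_insert, Finset.mem_singleton]
        clear * -
        tauto
      · simp [hvc₁'.symm, hvg₁.symm, hc₂₁.symm, hc₂g₁.symm, hc₁g₂, hg₂₁.symm]
    by_cases hy : ∃ a ∈ ({c, g₂} : Finset V), ∃ b ∈ S \ T, G.Adj a b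
    · obtain ⟨a, ha, b, hb, hab⟩ := hy
      refine GoodPacking.of_sdiff_path h3 (ihC {v, c₁, g₁} {c, g₂} (by simp) ?_ ?_
        ((cutConn_singleton c).union (cutConn_singleton g₂) (by simp) (by simp) hcg₂)
        a ha b hb hab) hvS hc₁S hg₁S hvg₁ hvc₁ hcg₁
      · rw [hT5]
        ext w
        simp only [Finset.mem_union, Finset.mem_insert, Finset.mem_singleton]
        clear * -
        tauto
      · simp [hvc₂'.symm, hvg₂.symm, hc₂₁, hc₁g₂.symm, hc₂g₁, hg₂₁]
    push Not at hx hy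
    have zc₁ := hzero c₁ (hx c₁ (by simp))
    have zg₁ := hzero g₁ (hx g₁ (by simp))
    have zc₂ := hzero c (hy c (by simp))
    have zg₂ := hzero g₂ (hy g₂ (by simp))
    refine (ih' T hv hrest).of_sdiff hTS hpT ?_
    have hsum : ∀ f : V → ℕ, ∑ a ∈ T, f a = f v + (f c₁ + (f c + (f g₁ + f g₂))) := by
      intro f
      rw [hT5, Finset.sum_insert (by simp [hvc₁', hvc₂', hvg₁, hvg₂]),
        Finset.sum_insert (by simp [hc₂₁.symm, hc₁g₁, hc₁g₂]),
        Finset.sum_insert (by simp [hc₂g₁, hc₂g₂]), Finset.sum_pair hg₂₁.symm]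
    rw [hsum]
    omega

/-- A set closed under adjacency in a cubic graph has a packing covering at least three quarters
of its vertices. -/
lemma exists_packing_of_closed (h3 : ∀ S a, degIn G S a ≤ 3) (S : Finset V)
    (hdeg : ∀ a ∈ S, degIn G S a = 3) : ∃ k, HasPacking G S k ∧ S.card ≤ 4 * k := by
  induction S using Finset.strongInduction with
  | H S ih =>
  rcases S.eq_empty_or_nonempty with rfl | ⟨w, hw⟩
  · exact ⟨0, HasPacking.zero _, by simp⟩
  obtain ⟨C, hCS, hwC, hcl, hCc⟩ := exists_component (G := G) hw
  have hCdeg : ∀ a ∈ C, degIn G C a = 3 := by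
    intro a ha
    refine le_antisymm (h3 C a) ?_
    rw [← hdeg a (hCS ha)]
    refine Finset.card_le_card fun b hb => ?_
    rw [Finset.mem_filter] at hb ⊢
    exact ⟨hcl a ha b hb.1 hb.2, hb.2⟩
  have hRdeg : ∀ a ∈ S \ C, degIn G (S \ C) a = 3 := by
    intro a ha
    refine le_antisymm (h3 _ a) ?_
    rw [← hdeg a (Finset.sdiff_subset ha)]
    refine Finset.card_le_card fun b hb => ?_
    rw [Finset.mem_filter] at hb ⊢
    exact ⟨hcl.sdiff a ha b hb.1 hb.2, hb.2⟩
  obtain ⟨k, hk, hle⟩ := ih (S \ C) (Finset.sdiff_ssubset hCS ⟨w, hwC⟩) hRdeg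
  obtain ⟨j, hj, hle'⟩ := goodPacking_of_cutConn h3 C hCc
  have heven := even_sum_degIn (G := G) C
  rw [Finset.sum_const_nat hCdeg] at heven hle'
  refine ⟨k + j, hk.union hj Finset.sdiff_disjoint Finset.sdiff_subset hCS, ?_⟩
  have := Finset.card_sdiff_add_card_eq_card hCS
  obtain ⟨r, hr⟩ := heven
  omega

end Helpers

/-- Every cubic graph `G` satisfies `λ(G) ≥ ⌈v(G)/4⌉`. -/
theorem stmt0 {V : Type*} [Fintype V] (G : SimpleGraph V) (hG : IsCubic G) :
    (Fintype.card V + 3) / 4 ≤ lambdaNum G := by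
  classical
  have huniv : ∀ a, degIn G Finset.univ a = 3 := by
    intro a
    rw [← hG a, degIn, ← Set.ncard_coe_finset]
    congr 1
    ext b
    simp
  obtain ⟨k, ⟨P, hP, -, rfl⟩, hle⟩ := exists_packing_of_closed
    (fun S a => (degIn_mono (Finset.subset_univ S) a).trans (huniv a).le) Finset.univ
    fun a _ => huniv a
  rw [Finset.card_univ] at hle
  have hbdd : BddAbove {n | ∃ P : Finset (V × V × V), IsPacking G P ∧ P.card = n} := by
    refine ⟨Fintype.card (V × V × V), ?_⟩
    rintro _ ⟨Q, -, rfl⟩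
    exact Finset.card_le_univ Q
  have hlam : P.card ≤ lambdaNum G := le_csSup hbdd ⟨P, hP, rfl⟩
  omega
end

section
/- If G is a graph in which every vertex has degree 2 or 3 and no connected component of G has exactly 5 vertices, then λ(G) ≥ ⌈v(G)/4⌉. -/
open SimpleGraph

section Core
variable {α : Type*} [DecidableEq α]

/-- The elements of `S` whose two endpoints both lie in `Z`. -/
def inner2 (S : Finset α) (K : α → Finset α) (Z : Finset α) : Finset α :=
  S.filter (fun s => (K s).card = 2 ∧ K s ⊆ Z)

/-- The elements of `S` with two endpoints, one being `d` and the other in `Z`. -/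
def joint2 (S : Finset α) (K : α → Finset α) (d : α) (Z : Finset α) : Finset α :=
  S.filter (fun s => (K s).card = 2 ∧ d ∈ K s ∧ K s ⊆ insert d Z)

theorem inner2_mono (S : Finset α) (K : α → Finset α) {Z W : Finset α} (h : Z ⊆ W) :
    inner2 S K Z ⊆ inner2 S K W := by
  intro s hs
  simp only [inner2, Finset.mem_filter] at hs ⊢
  exact ⟨hs.1, hs.2.1, hs.2.2.trans h⟩

theorem joint2_mono (S : Finset α) (K : α → Finset α) (d : α) {Z W : Finset α} (h : Z ⊆ W) :
    joint2 S K d Z ⊆ joint2 S K d W := by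
  intro s hs
  simp only [joint2, Finset.mem_filter] at hs ⊢
  exact ⟨hs.1, hs.2.1, hs.2.2.1, hs.2.2.2.trans (Finset.insert_subset_insert _ h)⟩

theorem inner2_supermodular (S : Finset α) (K : α → Finset α) (Z W : Finset α) :
    (inner2 S K Z).card + (inner2 S K W).card ≤
      (inner2 S K (Z ∪ W)).card + (inner2 S K (Z ∩ W)).card := by
  have h1 : inner2 S K Z ∩ inner2 S K W ⊆ inner2 S K (Z ∩ W) := by
    intro s hs
    simp only [inner2, Finset.mem_filter, Finset.mem_inter] at hs ⊢
    exact ⟨hs.1.1, hs.1.2.1, Finset.subset_inter hs.1.2.2 hs.2.2.2⟩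
  have h2 : inner2 S K Z ∪ inner2 S K W ⊆ inner2 S K (Z ∪ W) :=
    Finset.union_subset (inner2_mono S K Finset.subset_union_left)
      (inner2_mono S K Finset.subset_union_right)
  have := Finset.card_union_add_card_inter (inner2 S K Z) (inner2 S K W)
  have := Finset.card_le_card h1
  have := Finset.card_le_card h2
  omega

theorem inner2_insert_card (S : Finset α) (K : α → Finset α) {d : α} {Z : Finset α}
    (hd : d ∉ Z) :
    (inner2 S K (insert d Z)).card = (inner2 S K Z).card + (joint2 S K d Z).card := by
  rw [← Finset.card_union_of_disjoint]
  · congr 1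
    ext s
    simp only [inner2, joint2, Finset.mem_union, Finset.mem_filter]
    constructor
    · rintro ⟨hs, h2, hK⟩
      by_cases hdK : d ∈ K s
      · exact Or.inr ⟨hs, h2, hdK, hK⟩
      · exact Or.inl ⟨hs, h2, (Finset.subset_insert_iff_of_notMem hdK).1 hK⟩
    · rintro (⟨hs, h2, hK⟩ | ⟨hs, h2, -, hK⟩)
      · exact ⟨hs, h2, hK.trans (Finset.subset_insert _ _)⟩
      · exact ⟨hs, h2, hK⟩
  · rw [Finset.disjoint_left]
    intro s hs hs'
    simp only [inner2, joint2, Finset.mem_filter] at hs hs'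
    exact hd (hs.2.2 hs'.2.2.1)

theorem joint2_pairwise (S : Finset α) (K : α → Finset α) {d d' : α} {Z : Finset α}
    (hd' : d' ∉ Z) (h : d ≠ d') :
    Disjoint (joint2 S K d Z) (joint2 S K d' Z) := by
  rw [Finset.disjoint_left]
  intro s hs hs'
  simp only [joint2, Finset.mem_filter] at hs hs'
  have := hs.2.2.2 hs'.2.2.1
  rw [Finset.mem_insert] at this
  rcases this with h1 | h1
  · exact h h1.symm
  · exact hd' h1

theorem degree_count (S : Finset α) (K : α → Finset α) (B Z D : Finset α) (hZ : Z ⊆ B)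
    (hN : ∀ b ∈ B, (S.filter (fun s => b ∈ K s)).card = 3) (hD : Disjoint D Z) :
    2 * (inner2 S K Z).card + ∑ d ∈ D, (joint2 S K d Z).card ≤ 3 * Z.card := by
  have hDZ : ∀ d ∈ D, d ∉ Z := fun d hd => Finset.disjoint_left.1 hD hd
  have e1 : ∑ z ∈ Z, (S.filter (fun s => z ∈ K s)).card = 3 * Z.card := by
    rw [Finset.sum_congr rfl (fun z hz => hN z (hZ hz))]; simp [mul_comm]
  have e2 : ∑ z ∈ Z, (S.filter (fun s => z ∈ K s)).card
      = ∑ s ∈ S, (Z.filter (fun z => z ∈ K s)).card :=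
    Finset.sum_card_bipartiteAbove_eq_sum_card_bipartiteBelow (fun z s => z ∈ K s)
  set J := D.biUnion (fun d => joint2 S K d Z) with hJ
  have e3 : J.card = ∑ d ∈ D, (joint2 S K d Z).card :=
    Finset.card_biUnion (fun d _ d' hd' h => joint2_pairwise S K (hDZ d' hd') h)
  have hdisj : Disjoint (inner2 S K Z) J := by
    rw [Finset.disjoint_left]
    intro s hs hs'
    simp only [hJ, inner2, joint2, Finset.mem_filter, Finset.mem_biUnion] at hs hs'
    obtain ⟨d, hd, h⟩ := hs'
    exact hDZ d hd (hs.2.2 h.2.2.1)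
  have hsub : inner2 S K Z ∪ J ⊆ S := by
    intro s hs
    simp only [hJ, inner2, joint2, Finset.mem_filter, Finset.mem_biUnion, Finset.mem_union] at hs
    rcases hs with h | ⟨_, _, h⟩ <;> exact h.1
  have e4 := Finset.sum_le_sum_of_subset (f := fun s => (Z.filter (fun z => z ∈ K s)).card) hsub
  rw [Finset.sum_union hdisj] at e4
  have e5 : ∑ s ∈ inner2 S K Z, (Z.filter (fun z => z ∈ K s)).card
      = 2 * (inner2 S K Z).card := by
    rw [mul_comm, ← smul_eq_mul, ← Finset.sum_const]
    apply Finset.sum_congr rfl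
    intro s hs
    simp only [inner2, Finset.mem_filter] at hs
    rw [← hs.2.1]
    congr 1
    ext z
    simp only [Finset.mem_filter]
    exact ⟨fun h => h.2, fun h => ⟨hs.2.2 h, h⟩⟩
  have e6 : J.card ≤ ∑ s ∈ J, (Z.filter (fun z => z ∈ K s)).card := by
    rw [Finset.card_eq_sum_ones]
    apply Finset.sum_le_sum
    intro s hs
    simp only [hJ, joint2, Finset.mem_filter, Finset.mem_biUnion] at hs
    obtain ⟨d, hd, -, h2, hdK, hK⟩ := hs
    obtain ⟨z, hz, hzd⟩ := Finset.exists_mem_ne (by omega : 1 < (K s).card) d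
    apply Finset.card_pos.2
    refine ⟨z, Finset.mem_filter.2 ⟨?_, hz⟩⟩
    exact Finset.mem_of_mem_insert_of_ne (hK hz) hzd
  omega

/-- Every subset of `Y` spans at most as many edges as it has vertices. -/
def Sparse (S : Finset α) (K : α → Finset α) (Y : Finset α) : Prop :=
  ∀ Z ⊆ Y, (inner2 S K Z).card ≤ Z.card

theorem sparse_assignment (S : Finset α) (K : α → Finset α) (B Y : Finset α) (hY : Y ⊆ B)
    (hN : ∀ b ∈ B, (S.filter (fun s => b ∈ K s)).card = 3)
    (hK : ∀ s ∈ S, (K s).card = 1 ∨ (K s).card = 2) (hs : Sparse S K Y) :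
    ∃ f g : α → α, (∀ y ∈ Y, f y ∈ S ∧ g y ∈ S ∧ f y ≠ g y ∧ y ∈ K (f y) ∧ y ∈ K (g y)) ∧
      ∀ y ∈ Y, ∀ y' ∈ Y, y ≠ y' →
        Disjoint ({f y, g y} : Finset α) ({f y', g y'} : Finset α) := by
  have hall : ∃ φ : {s // s ∈ inner2 S K Y} → α, Function.Injective φ ∧ ∀ s, φ s ∈ K s.1 := by
    rw [← Finset.all_card_le_biUnion_card_iff_exists_injective]
    intro F
    set Z := F.biUnion (fun s => K s.1)
    have hZY : Z ⊆ Y := by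
      apply Finset.biUnion_subset.2
      intro s _
      have := s.2
      simp only [inner2, Finset.mem_filter] at this
      exact this.2.2
    have hF : F.map (Function.Embedding.subtype _) ⊆ inner2 S K Z := by
      intro s hs
      simp only [Finset.mem_map, Function.Embedding.subtype_apply] at hs
      obtain ⟨t, ht, rfl⟩ := hs
      have h2 := t.2
      simp only [inner2, Finset.mem_filter] at h2 ⊢
      exact ⟨h2.1, h2.2.1, Finset.subset_biUnion_of_mem (fun s : {s // s ∈ inner2 S K Y} => K s.1) ht⟩
    have := Finset.card_le_card hF
    rw [Finset.card_map] at this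
    exact this.trans (hs Z hZY)
  obtain ⟨φ, hφ, hφK⟩ := hall
  have hlost : ∀ y ∈ Y, ∃ a b, a ≠ b ∧ (a ∈ S ∧ y ∈ K a ∧ ∀ h : a ∈ inner2 S K Y, φ ⟨a, h⟩ ≠ y) ∧
      (b ∈ S ∧ y ∈ K b ∧ ∀ h : b ∈ inner2 S K Y, φ ⟨b, h⟩ ≠ y) := by
    intro y hy
    obtain ⟨a, b, c, hab, hac, hbc, habc⟩ := Finset.card_eq_three.1 (hN y (hY hy))
    have ha : a ∈ S ∧ y ∈ K a := by
      have : a ∈ S.filter (fun s => y ∈ K s) := by rw [habc]; simp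
      simpa using this
    have hb : b ∈ S ∧ y ∈ K b := by
      have : b ∈ S.filter (fun s => y ∈ K s) := by rw [habc]; simp
      simpa using this
    have hc : c ∈ S ∧ y ∈ K c := by
      have : c ∈ S.filter (fun s => y ∈ K s) := by rw [habc]; simp
      simpa using this
    have uniq : ∀ s t, s ≠ t → (∃ h : s ∈ inner2 S K Y, φ ⟨s, h⟩ = y) →
        ∀ h : t ∈ inner2 S K Y, φ ⟨t, h⟩ ≠ y := by
      rintro s t hst ⟨h, e⟩ h' e'
      exact hst (congrArg Subtype.val (hφ (e.trans e'.symm)))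
    by_cases h1 : ∃ h : a ∈ inner2 S K Y, φ ⟨a, h⟩ = y
    · exact ⟨b, c, hbc, ⟨hb.1, hb.2, uniq a b hab h1⟩, ⟨hc.1, hc.2, uniq a c hac h1⟩⟩
    · by_cases h2 : ∃ h : b ∈ inner2 S K Y, φ ⟨b, h⟩ = y
      · exact ⟨a, c, hac, ⟨ha.1, ha.2, fun h e => h1 ⟨h, e⟩⟩, ⟨hc.1, hc.2, uniq b c hbc h2⟩⟩
      · exact ⟨a, b, hab, ⟨ha.1, ha.2, fun h e => h1 ⟨h, e⟩⟩, ⟨hb.1, hb.2, fun h e => h2 ⟨h, e⟩⟩⟩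
  have hdis : ∀ y ∈ Y, ∀ y' ∈ Y, y ≠ y' → ∀ s, s ∈ S → y ∈ K s → y' ∈ K s →
      (∀ h : s ∈ inner2 S K Y, φ ⟨s, h⟩ ≠ y) → (∀ h : s ∈ inner2 S K Y, φ ⟨s, h⟩ ≠ y') → False := by
    intro y hy y' hy' hne s hsS h1 h2 h3 h4
    have hsub : ({y, y'} : Finset α) ⊆ K s := by
      intro z hz
      simp only [Finset.mem_insert, Finset.mem_singleton] at hz
      rcases hz with rfl | rfl <;> assumption
    have hc : ({y, y'} : Finset α).card = 2 := Finset.card_pair hne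
    have hle := Finset.card_le_card hsub
    have h2' : (K s).card = 2 := by rcases hK s hsS with h | h <;> omega
    have heq : ({y, y'} : Finset α) = K s := Finset.eq_of_subset_of_card_le hsub (by omega)
    have hin : s ∈ inner2 S K Y := by
      simp only [inner2, Finset.mem_filter]
      refine ⟨hsS, h2', ?_⟩
      rw [← heq]
      intro z hz
      simp only [Finset.mem_insert, Finset.mem_singleton] at hz
      rcases hz with rfl | rfl <;> assumption
    have := hφK ⟨s, hin⟩
    simp only [← heq, Finset.mem_insert, Finset.mem_singleton] at this
    rcases this with h | h
    · exact h3 hin h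
    · exact h4 hin h
  choose! f g hfg using hlost
  refine ⟨f, g, fun y hy => ?_, fun y hy y' hy' hne => ?_⟩
  · obtain ⟨h1, h2, h3⟩ := hfg y hy
    exact ⟨h2.1, h3.1, h1, h2.2.1, h3.2.1⟩
  · obtain ⟨-, h2, h3⟩ := hfg y hy
    obtain ⟨-, h2', h3'⟩ := hfg y' hy'
    rw [Finset.disjoint_left]
    intro s hs hs'
    simp only [Finset.mem_insert, Finset.mem_singleton] at hs hs'
    have A : s ∈ S ∧ y ∈ K s ∧ ∀ h : s ∈ inner2 S K Y, φ ⟨s, h⟩ ≠ y := by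
      rcases hs with rfl | rfl <;> assumption
    have A' : s ∈ S ∧ y' ∈ K s ∧ ∀ h : s ∈ inner2 S K Y, φ ⟨s, h⟩ ≠ y' := by
      rcases hs' with rfl | rfl <;> assumption
    exact hdis y hy y' hy' hne s A.1 A.2.1 A'.2.1 A.2.2 A'.2.2

theorem eq_pair_of_card_two {s : Finset α} (h : s.card = 2) {a b : α} (ha : a ∈ s) (hb : b ∈ s)
    (hab : a ≠ b) : s = {a, b} := by
  symm
  apply Finset.eq_of_subset_of_card_le
  · intro z hz
    simp only [Finset.mem_insert, Finset.mem_singleton] at hz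
    rcases hz with rfl | rfl <;> assumption
  · rw [h, Finset.card_pair hab]

theorem sparse_maximal_count (S : Finset α) (K : α → Finset α) (B Y : Finset α) (hY : Y ⊆ B)
    (hKB : ∀ s ∈ S, K s ⊆ B)
    (hN : ∀ b ∈ B, (S.filter (fun s => b ∈ K s)).card = 3)
    (hθ : ∀ b ∈ B, ∀ b' ∈ B,
      S.filter (fun s => b ∈ K s) = S.filter (fun s => b' ∈ K s) → b = b')
    (hs : Sparse S K Y) (hmax : ∀ d ∈ B, d ∉ Y → ¬ Sparse S K (insert d Y)) :
    4 * (B \ Y).card ≤ (inner2 S K B).card := by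
  have hempty : (inner2 S K ∅).card = 0 := by
    rw [Finset.card_eq_zero, Finset.eq_empty_iff_forall_notMem]
    intro s hs
    simp only [inner2, Finset.mem_filter, Finset.subset_empty] at hs
    rw [hs.2.2] at hs; simp at hs
  obtain ⟨C, hCmem, hCmax⟩ := Finset.exists_max_image
    (Y.powerset.filter (fun Z => (inner2 S K Z).card = Z.card)) Finset.card
    ⟨∅, by simp [hempty]⟩
  simp only [Finset.mem_filter, Finset.mem_powerset] at hCmem hCmax
  obtain ⟨hCY, hCt⟩ := hCmem
  have hCall : ∀ Z ⊆ Y, (inner2 S K Z).card = Z.card → Z ⊆ C := by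
    intro Z hZ hZt
    have h1 := inner2_supermodular S K Z C
    have h2 := hs (Z ∪ C) (Finset.union_subset hZ hCY)
    have h3 := hs (Z ∩ C) (Finset.inter_subset_left.trans hZ)
    have h4 := Finset.card_union_add_card_inter Z C
    have h5 := hCmax (Z ∪ C) ⟨Finset.union_subset hZ hCY, by omega⟩
    have h6 := Finset.eq_of_subset_of_card_le (Finset.subset_union_right : C ⊆ Z ∪ C) h5
    rw [h6]; exact Finset.subset_union_left
  set T := Y \ C with hT
  have hTY : T ⊆ Y := Finset.sdiff_subset
  have hTC : ∀ y ∈ T, y ∉ C := fun y hy => (Finset.mem_sdiff.1 hy).2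
  have hTlt : ∀ Z ⊆ T, Z.Nonempty → (inner2 S K Z).card < Z.card := by
    intro Z hZ ⟨z, hz⟩
    refine lt_of_le_of_ne (hs Z (hZ.trans hTY)) fun h => ?_
    exact hTC z (hZ hz) (hCall Z (hZ.trans hTY) h hz)
  have hcross : ∀ y ∈ T, (joint2 S K y C).card = 0 := by
    intro y hy
    by_contra h
    have h1 := inner2_insert_card S K (hTC y hy)
    have hsub : insert y C ⊆ Y := Finset.insert_subset (hTY hy) hCY
    have h2 := hs _ hsub
    have h3 := Finset.card_insert_of_notMem (hTC y hy)
    exact hTC y hy (hCall _ hsub (by omega) (Finset.mem_insert_self _ _))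
  have hJ3 : ∀ d ∈ B, ∀ Z, (joint2 S K d Z).card ≤ 3 := by
    intro d hd Z
    rw [← hN d hd]
    apply Finset.card_le_card
    intro s hs
    simp only [joint2, Finset.mem_filter] at hs ⊢
    exact ⟨hs.1, hs.2.2.1⟩
  have hJmono : ∀ d, ∀ Z W : Finset α, Z ⊆ W → (joint2 S K d Z).card ≤ (joint2 S K d W).card :=
    fun d Z W h => Finset.card_le_card (joint2_mono S K d h)
  have hclass : ∀ d ∈ B \ Y, 2 ≤ (joint2 S K d C).card ∨
      (1 ≤ (joint2 S K d C).card ∧ (joint2 S K d Y).card = 3) ∨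
      ((joint2 S K d C).card = 0 ∧ (joint2 S K d Y).card = 3 ∧
        ∃ Z ⊆ T, (inner2 S K Z).card + 1 = Z.card ∧ (joint2 S K d Z).card = 3) := by
    intro d hd
    obtain ⟨hdB, hdY⟩ := Finset.mem_sdiff.1 hd
    have hns := hmax d hdB hdY
    unfold Sparse at hns
    push Not at hns
    obtain ⟨W, hW, hWlt⟩ := hns
    have hdW : d ∈ W := by
      by_contra h
      have := hs W ((Finset.subset_insert_iff_of_notMem h).1 hW)
      omega
    set Z := W.erase d with hZ
    have hZY : Z ⊆ Y := Finset.subset_insert_iff.1 hW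
    have hdZ : d ∉ Z := Finset.notMem_erase _ _
    have hWZ : insert d Z = W := Finset.insert_erase hdW
    have h1 := inner2_insert_card S K hdZ
    have h2 := Finset.card_insert_of_notMem hdZ
    rw [hWZ] at h1 h2
    have h3 := hs Z hZY
    have h4 := hJ3 d hdB Z
    by_cases ht : (inner2 S K Z).card = Z.card
    · left
      have := hJmono d Z C (hCall Z hZY ht)
      omega
    right
    have h5 := hJmono d Z Y hZY
    have h6 := hJ3 d hdB Y
    by_cases h0 : (joint2 S K d C).card = 0
    swap
    · left; omega
    right
    refine ⟨h0, by omega, Z \ C, Finset.sdiff_subset_sdiff hZY le_rfl, ?_⟩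
    have hjeq : joint2 S K d Z ⊆ joint2 S K d (Z \ C) := by
      intro s hsJ
      simp only [joint2, Finset.mem_filter] at hsJ ⊢
      refine ⟨hsJ.1, hsJ.2.1, hsJ.2.2.1, fun x hx => ?_⟩
      rcases Finset.mem_insert.1 (hsJ.2.2.2 hx) with rfl | hxZ
      · exact Finset.mem_insert_self _ _
      by_cases hxC : x ∈ C
      · exfalso
        have hxd : d ≠ x := by rintro rfl; exact hdZ hxZ
        have := eq_pair_of_card_two hsJ.2.1 hsJ.2.2.1 hx hxd
        have hmem : s ∈ joint2 S K d C := by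
          simp only [joint2, Finset.mem_filter]
          refine ⟨hsJ.1, hsJ.2.1, hsJ.2.2.1, ?_⟩
          rw [this]
          intro z hz
          simp only [Finset.mem_insert, Finset.mem_singleton] at hz ⊢
          rcases hz with rfl | rfl
          · exact Or.inl rfl
          · exact Or.inr hxC
        rw [Finset.card_eq_zero.1 h0] at hmem
        simp at hmem
      · exact Finset.mem_insert_of_mem (Finset.mem_sdiff.2 ⟨hxZ, hxC⟩)
    have hieq : inner2 S K Z ⊆ inner2 S K (Z ∩ C) ∪ inner2 S K (Z \ C) := by
      intro s hsI
      simp only [inner2, Finset.mem_filter, Finset.mem_union] at hsI ⊢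
      by_cases hall : K s ⊆ C
      · exact Or.inl ⟨hsI.1, hsI.2.1, Finset.subset_inter hsI.2.2 hall⟩
      right
      refine ⟨hsI.1, hsI.2.1, fun x hx => Finset.mem_sdiff.2 ⟨hsI.2.2 hx, fun hxC => ?_⟩⟩
      obtain ⟨y, hy, hyC⟩ := Finset.not_subset.1 hall
      have hyx : y ≠ x := by rintro rfl; exact hyC hxC
      have hyT : y ∈ T := Finset.mem_sdiff.2 ⟨hZY (hsI.2.2 hy), hyC⟩
      have := eq_pair_of_card_two hsI.2.1 hy hx hyx
      have hmem : s ∈ joint2 S K y C := by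
        simp only [joint2, Finset.mem_filter]
        refine ⟨hsI.1, hsI.2.1, hy, ?_⟩
        rw [this]
        intro z hz
        simp only [Finset.mem_insert, Finset.mem_singleton] at hz ⊢
        rcases hz with rfl | rfl
        · exact Or.inl rfl
        · exact Or.inr hxC
      rw [Finset.card_eq_zero.1 (hcross y hyT)] at hmem
      simp at hmem
    have h7 := Finset.card_le_card hjeq
    have h8 := hJ3 d hdB (Z \ C)
    have h9 := (Finset.card_le_card hieq).trans (Finset.card_union_le _ _)
    have h10 := hs (Z ∩ C) (Finset.inter_subset_left.trans hZY)
    have h11 := Finset.card_inter_add_card_sdiff Z C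
    have hne : (Z \ C).Nonempty := by
      have hpos : 0 < (joint2 S K d (Z \ C)).card := by omega
      obtain ⟨s, hsJ⟩ := Finset.card_pos.1 hpos
      simp only [joint2, Finset.mem_filter] at hsJ
      obtain ⟨z, hz, hzd⟩ := Finset.exists_mem_ne (by omega : 1 < (K s).card) d
      exact ⟨z, Finset.mem_of_mem_insert_of_ne (hsJ.2.2.2 hz) hzd⟩
    have h12 := hTlt (Z \ C) (Finset.sdiff_subset_sdiff hZY le_rfl) hne
    omega
  set D3 := (B \ Y).filter (fun d => (joint2 S K d C).card = 0) with hD3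
  have hD3card : D3.card ≤ (inner2 S K T).card := by
    have hex : ∀ d ∈ D3, ∃ M ⊆ T, (inner2 S K M).card + 1 = M.card ∧ (joint2 S K d M).card = 3 ∧
        ∀ W ⊆ T, (inner2 S K W).card + 1 = W.card → (W ∩ M).Nonempty → W ⊆ M := by
      intro d hd
      obtain ⟨hdD, hd0⟩ := Finset.mem_filter.1 hd
      have hdB := (Finset.mem_sdiff.1 hdD).1
      obtain ⟨Z, hZT, hZ1, hZ3⟩ : ∃ Z ⊆ T, (inner2 S K Z).card + 1 = Z.card ∧
          (joint2 S K d Z).card = 3 := by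
        rcases hclass d hdD with h | ⟨h, -⟩ | ⟨-, -, h⟩
        · omega
        · omega
        · exact h
      obtain ⟨M, hM, hMmax⟩ := Finset.exists_max_image
        (T.powerset.filter (fun Z => (inner2 S K Z).card + 1 = Z.card ∧
          (joint2 S K d Z).card = 3)) Finset.card
        ⟨Z, Finset.mem_filter.2 ⟨Finset.mem_powerset.2 hZT, hZ1, hZ3⟩⟩
      simp only [Finset.mem_filter, Finset.mem_powerset] at hM hMmax
      refine ⟨M, hM.1, hM.2.1, hM.2.2, fun W hW hW1 hne => ?_⟩
      have h1 := inner2_supermodular S K W M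
      have h3 := hTlt (W ∩ M) (Finset.inter_subset_left.trans hW) hne
      have hU : W ∪ M ⊆ T := Finset.union_subset hW hM.1
      have h2 := hTlt (W ∪ M) hU (hne.mono (Finset.inter_subset_left.trans Finset.subset_union_left))
      have h4 := Finset.card_union_add_card_inter W M
      have h7 := hJmono d M (W ∪ M) Finset.subset_union_right
      have h8 := hJ3 d hdB (W ∪ M)
      have h5 := hMmax (W ∪ M) ⟨hU, by omega, by omega⟩
      rw [Finset.eq_of_subset_of_card_le (Finset.subset_union_right : M ⊆ W ∪ M) h5]
      exact Finset.subset_union_left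
    choose! M hMT hM1 hM3 hMmax using hex
    rw [Finset.card_eq_sum_card_image M D3]
    have hpd : ∀ m ∈ D3.image M, ∀ m' ∈ D3.image M, m ≠ m' →
        Disjoint (inner2 S K m) (inner2 S K m') := by
      intro m hm m' hm' hne
      obtain ⟨d, hd, rfl⟩ := Finset.mem_image.1 hm
      obtain ⟨d', hd', rfl⟩ := Finset.mem_image.1 hm'
      rw [Finset.disjoint_left]
      intro s h1 h2
      simp only [inner2, Finset.mem_filter] at h1 h2
      apply hne
      have hpos : 0 < (K s).card := by omega
      obtain ⟨z, hz⟩ := Finset.card_pos.1 hpos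
      apply Finset.Subset.antisymm
      · exact hMmax d' hd' _ (hMT d hd) (hM1 d hd)
          ⟨z, Finset.mem_inter.2 ⟨h1.2.2 hz, h2.2.2 hz⟩⟩
      · exact hMmax d hd _ (hMT d' hd') (hM1 d' hd')
          ⟨z, Finset.mem_inter.2 ⟨h2.2.2 hz, h1.2.2 hz⟩⟩
    have hle : ∑ m ∈ D3.image M, (inner2 S K m).card ≤ (inner2 S K T).card := by
      rw [← Finset.card_biUnion hpd]
      apply Finset.card_le_card
      apply Finset.biUnion_subset.2
      intro m hm
      obtain ⟨d, hd, rfl⟩ := Finset.mem_image.1 hm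
      exact inner2_mono S K (hMT d hd)
    refine le_trans (Finset.sum_le_sum fun m hm => ?_) hle
    obtain ⟨d₀, hd₀, rfl⟩ := Finset.mem_image.1 hm
    set q := D3.filter (fun d => M d = M d₀) with hq
    have hMB : M d₀ ⊆ B := ((hMT d₀ hd₀).trans hTY).trans hY
    have hqd : Disjoint q (M d₀) := by
      rw [Finset.disjoint_left]
      intro d hd hdM
      have h1 := (Finset.mem_filter.1 (Finset.mem_filter.1 hd).1).1
      exact (Finset.mem_sdiff.1 h1).2 (hTY (hMT d₀ hd₀ hdM))
    have hdc := degree_count S K B (M d₀) q hMB hN hqd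
    have hsum : ∑ d ∈ q, (joint2 S K d (M d₀)).card = 3 * q.card := by
      rw [mul_comm, ← smul_eq_mul, ← Finset.sum_const]
      apply Finset.sum_congr rfl
      intro d hd
      obtain ⟨hd1, hd2⟩ := Finset.mem_filter.1 hd
      rw [← hd2]; exact hM3 d hd1
    have hm1 := hM1 d₀ hd₀
    have hnz : (inner2 S K (M d₀)).card ≠ 0 := by
      intro h0
      obtain ⟨y, hy⟩ := Finset.card_eq_one.1 (by omega : (M d₀).card = 1)
      have hyT : y ∈ T := hMT d₀ hd₀ (by rw [hy]; simp)
      have hyB := hY (hTY hyT)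
      have h1 := (Finset.mem_filter.1 hd₀).1
      obtain ⟨hdB, hdY⟩ := Finset.mem_sdiff.1 h1
      have hsub1 : joint2 S K d₀ (M d₀) ⊆ S.filter (fun s => d₀ ∈ K s) := by
        intro s hs
        simp only [joint2, Finset.mem_filter] at hs ⊢
        exact ⟨hs.1, hs.2.2.1⟩
      have heq := Finset.eq_of_subset_of_card_le hsub1 (by rw [hN d₀ hdB, hM3 d₀ hd₀])
      have hsub2 : S.filter (fun s => d₀ ∈ K s) ⊆ S.filter (fun s => y ∈ K s) := by
        rw [← heq]
        intro s hs
        simp only [joint2, Finset.mem_filter] at hs ⊢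
        refine ⟨hs.1, ?_⟩
        obtain ⟨z, hz, hzd⟩ := Finset.exists_mem_ne (by omega : 1 < (K s).card) d₀
        have := Finset.mem_of_mem_insert_of_ne (hs.2.2.2 hz) hzd
        rw [hy, Finset.mem_singleton] at this
        rwa [← this]
      have heq2 := Finset.eq_of_subset_of_card_le hsub2 (by rw [hN d₀ hdB, hN y hyB])
      have := hθ d₀ hdB y hyB heq2
      rw [this] at hdY
      exact hdY (hTY hyT)
    omega
  have hdisjDC : Disjoint (B \ Y) C := by
    rw [Finset.disjoint_left]
    intro d hd hdC
    exact (Finset.mem_sdiff.1 hd).2 (hCY hdC)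
  have hC := degree_count S K B C (B \ Y) (hCY.trans hY) hN hdisjDC
  set J := (B \ Y).biUnion (fun d => joint2 S K d Y) with hJ
  have hJcard : J.card = ∑ d ∈ B \ Y, (joint2 S K d Y).card :=
    Finset.card_biUnion (fun d _ d' hd' h =>
      joint2_pairwise S K (Finset.mem_sdiff.1 hd').2 h)
  have hd1 : Disjoint (inner2 S K C) (inner2 S K T) := by
    rw [Finset.disjoint_left]
    intro s h1 h2
    simp only [inner2, Finset.mem_filter] at h1 h2
    have hpos : 0 < (K s).card := by omega
    obtain ⟨z, hz⟩ := Finset.card_pos.1 hpos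
    exact hTC z (h2.2.2 hz) (h1.2.2 hz)
  have hd2 : Disjoint (inner2 S K C ∪ inner2 S K T) J := by
    rw [Finset.disjoint_left]
    intro s h1 h2
    simp only [hJ, inner2, joint2, Finset.mem_filter, Finset.mem_biUnion, Finset.mem_union] at h1 h2
    obtain ⟨d, hd, -, -, hdK, -⟩ := h2
    apply (Finset.mem_sdiff.1 hd).2
    rcases h1 with h | h
    · exact hCY (h.2.2 hdK)
    · exact hTY (h.2.2 hdK)
  have hsub : inner2 S K C ∪ inner2 S K T ∪ J ⊆ inner2 S K B := by
    intro s h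
    simp only [hJ, inner2, joint2, Finset.mem_filter, Finset.mem_biUnion, Finset.mem_union] at h ⊢
    rcases h with (h | h) | ⟨_, _, h⟩ <;> exact ⟨h.1, h.2.1, hKB s h.1⟩
  have hcard := Finset.card_le_card hsub
  rw [Finset.card_union_of_disjoint hd2, Finset.card_union_of_disjoint hd1] at hcard
  have hfin : ∑ d ∈ B \ Y, 4 ≤ ∑ d ∈ B \ Y, ((joint2 S K d C).card + (joint2 S K d Y).card +
      if (joint2 S K d C).card = 0 then 1 else 0) := by
    apply Finset.sum_le_sum
    intro d hd
    have := hJmono d C Y hCY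
    rcases hclass d hd with h | ⟨h, h'⟩ | ⟨h, h', -⟩
    · split_ifs <;> omega
    · split_ifs <;> omega
    · rw [if_pos h]; omega
  rw [Finset.sum_add_distrib, Finset.sum_add_distrib, ← Finset.card_filter, ← hD3,
    Finset.sum_const, smul_eq_mul] at hfin
  omega

theorem two_leaf_star_packing (S : Finset α) (K : α → Finset α) (B : Finset α)
    (hKB : ∀ s ∈ S, K s ⊆ B)
    (hN : ∀ b ∈ B, (S.filter (fun s => b ∈ K s)).card = 3)
    (hK : ∀ s ∈ S, (K s).card = 1 ∨ (K s).card = 2)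
    (hθ : ∀ b ∈ B, ∀ b' ∈ B,
      S.filter (fun s => b ∈ K s) = S.filter (fun s => b' ∈ K s) → b = b') :
    ∃ Y ⊆ B, ∃ f g : α → α,
      (∀ y ∈ Y, f y ∈ S ∧ g y ∈ S ∧ f y ≠ g y ∧ y ∈ K (f y) ∧ y ∈ K (g y)) ∧
      (∀ y ∈ Y, ∀ y' ∈ Y, y ≠ y' →
        Disjoint ({f y, g y} : Finset α) ({f y', g y'} : Finset α)) ∧
      B.card + S.card ≤ 4 * Y.card := by
  classical
  have h0 : Sparse S K ∅ := by
    intro Z hZ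
    rw [Finset.subset_empty.1 hZ, Finset.card_empty, Nat.le_zero, Finset.card_eq_zero,
      Finset.eq_empty_iff_forall_notMem]
    intro s hs
    simp only [inner2, Finset.mem_filter, Finset.subset_empty] at hs
    rw [hs.2.2] at hs; simp at hs
  obtain ⟨Y, hYm, hYmax⟩ := Finset.exists_max_image
    (B.powerset.filter (fun Y => Sparse S K Y)) Finset.card ⟨∅, by simp [h0]⟩
  simp only [Finset.mem_filter, Finset.mem_powerset] at hYm hYmax
  obtain ⟨hYB, hYs⟩ := hYm
  have hc := sparse_maximal_count S K B Y hYB hKB hN hθ hYs (fun d hd hdY h => by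
    have h1 := hYmax (insert d Y) ⟨Finset.insert_subset hd hYB, h⟩
    rw [Finset.card_insert_of_notMem hdY] at h1
    omega)
  obtain ⟨f, g, h1, h2⟩ := sparse_assignment S K B Y hYB hN hK hYs
  refine ⟨Y, hYB, f, g, h1, h2, ?_⟩
  have e1 : ∑ z ∈ B, (S.filter (fun s => z ∈ K s)).card = 3 * B.card := by
    rw [Finset.sum_congr rfl hN]; simp [mul_comm]
  have e2 : ∑ z ∈ B, (S.filter (fun s => z ∈ K s)).card
      = ∑ s ∈ S, (B.filter (fun z => z ∈ K s)).card :=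
    Finset.sum_card_bipartiteAbove_eq_sum_card_bipartiteBelow (fun z s => z ∈ K s)
  have e3 : ∑ s ∈ S, (B.filter (fun z => z ∈ K s)).card
      = ∑ s ∈ S, (1 + if (K s).card = 2 ∧ K s ⊆ B then 1 else 0) := by
    apply Finset.sum_congr rfl
    intro s hs
    have : B.filter (fun z => z ∈ K s) = K s := by
      ext z
      simp only [Finset.mem_filter]
      exact ⟨fun h => h.2, fun h => ⟨hKB s hs h, h⟩⟩
    rw [this]
    rcases hK s hs with h | h <;> simp [h, hKB s hs]
  rw [Finset.sum_add_distrib, ← Finset.card_filter] at e3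
  have e4 : (S.filter (fun s => (K s).card = 2 ∧ K s ⊆ B)).card = (inner2 S K B).card := rfl
  simp only [Finset.sum_const, smul_eq_mul, mul_one] at e3
  have e5 := Finset.card_sdiff_add_card_eq_card hYB
  omega
end Core

section Graph
set_option linter.unusedSectionVars false
variable {V : Type*} [Fintype V] [DecidableEq V]

/-- The neighbours of `v`, as a finset. -/
noncomputable def nb (G : SimpleGraph V) (v : V) : Finset V :=
  (G.neighborSet v).toFinite.toFinset

/-- The vertices of `G` of positive degree. -/
noncomputable def posVerts (G : SimpleGraph V) : Finset V :=
  Finset.univ.filter (fun v => (nb G v).card ≠ 0)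

/-- `G` has `k` disjoint 3-vertex paths, all inside `R`. -/
def Packs (G : SimpleGraph V) (R : Finset V) (k : ℕ) : Prop :=
  ∃ P, IsPacking G P ∧ P.card = k ∧ ∀ p ∈ P, pVerts p ⊆ ↑R

theorem mem_posVerts {G : SimpleGraph V} {v : V} : v ∈ posVerts G ↔ (nb G v).card ≠ 0 := by
  simp [posVerts]

@[simp] theorem mem_nb {G : SimpleGraph V} {v w : V} : w ∈ nb G v ↔ G.Adj v w := by
  simp [nb]

theorem Packs.mono {G G' : SimpleGraph V} {R R' : Finset V} {k : ℕ} (h : Packs G R k)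
    (hR : R ⊆ R') (hG : ∀ u ∈ R, ∀ v ∈ R, G.Adj u v → G'.Adj u v) : Packs G' R' k := by
  obtain ⟨P, hP, hk, hPR⟩ := h
  refine ⟨P, ⟨fun p hp => ?_, hP.2⟩, hk, fun p hp => (hPR p hp).trans (by exact_mod_cast hR)⟩
  obtain ⟨a, b, c, d, e⟩ := hP.1 p hp
  have := hPR p hp
  simp only [pVerts, Set.insert_subset_iff, Set.singleton_subset_iff, Finset.mem_coe] at this
  exact ⟨a, b, c, hG _ this.1 _ this.2.1 d, hG _ this.2.1 _ this.2.2 e⟩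

theorem Packs.subset {G : SimpleGraph V} {R R' : Finset V} {k : ℕ} (h : Packs G R k)
    (hR : R ⊆ R') : Packs G R' k := h.mono hR fun _ _ _ _ h => h

theorem Packs.zero (G : SimpleGraph V) (R : Finset V) : Packs G R 0 :=
  ⟨∅, by simp [IsPacking], rfl, by simp⟩

theorem Packs.union {G : SimpleGraph V} {R R' : Finset V} {k k' : ℕ} (h : Packs G R k)
    (h' : Packs G R' k') (hd : Disjoint R R') : Packs G (R ∪ R') (k + k') := by
  obtain ⟨P, hP, hk, hPR⟩ := h
  obtain ⟨P', hP', hk', hPR'⟩ := h'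
  have hdis : ∀ p ∈ P, ∀ q ∈ P', Disjoint (pVerts p) (pVerts q) := fun p hp q hq =>
    (Finset.disjoint_coe.2 hd).mono (hPR p hp) (hPR' q hq)
  have hPP : Disjoint P P' := by
    rw [Finset.disjoint_left]
    intro p hp hp'
    have := hdis p hp p hp'
    rw [disjoint_self] at this
    have h1 : p.1 ∈ pVerts p := by simp [pVerts]
    rw [this] at h1
    exact h1
  refine ⟨P ∪ P', ⟨?_, ?_⟩, by rw [Finset.card_union_of_disjoint hPP, hk, hk'], ?_⟩
  · intro p hp
    exact (Finset.mem_union.1 hp).elim (hP.1 p) (hP'.1 p)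
  · intro p hp q hq hpq
    rcases Finset.mem_union.1 hp with hp | hp <;> rcases Finset.mem_union.1 hq with hq | hq
    · exact hP.2 p hp q hq hpq
    · exact hdis p hp q hq
    · exact (hdis q hq p hp).symm
    · exact hP'.2 p hp q hq hpq
  · intro p hp
    rw [Finset.coe_union]
    exact (Finset.mem_union.1 hp).elim (fun h => (hPR p h).trans Set.subset_union_left)
      (fun h => (hPR' p h).trans Set.subset_union_right)

theorem Packs.add {G : SimpleGraph V} {R R' T : Finset V} {k k' : ℕ} (h : Packs G R k)
    (h' : Packs G R' k') (hd : Disjoint R R') (hT : R ∪ R' ⊆ T) : Packs G T (k + k') :=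
  (h.union h' hd).subset hT

theorem packs_one {G : SimpleGraph V} {R : Finset V} {a b c : V} (hab : G.Adj a b)
    (hbc : G.Adj b c) (hac : a ≠ c) (ha : a ∈ R) (hb : b ∈ R) (hc : c ∈ R) : Packs G R 1 := by
  refine ⟨{(a, b, c)}, ⟨?_, by simp⟩, rfl, ?_⟩
  · simpa [IsPathL] using ⟨hab.ne, hbc.ne, hac, hab, hbc⟩
  · simp [pVerts, Set.insert_subset_iff, ha, hb, hc]

theorem Packs.biUnion {ι : Type*} [DecidableEq ι] {G : SimpleGraph V} (s : Finset ι)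
    (R : ι → Finset V) (h : ∀ i ∈ s, Packs G (R i) 1)
    (hd : ∀ i ∈ s, ∀ j ∈ s, i ≠ j → Disjoint (R i) (R j)) :
    Packs G (s.biUnion R) s.card := by
  induction s using Finset.induction_on with
  | empty => exact Packs.zero _ _
  | insert i s his ih =>
    rw [Finset.card_insert_of_notMem his, Finset.biUnion_insert, add_comm]
    refine (h i (by simp)).union (ih (fun j hj => h j (by simp [hj])) fun j hj l hl =>
      hd j (by simp [hj]) l (by simp [hl])) ?_
    rw [Finset.disjoint_biUnion_right]
    intro j hj
    exact hd i (by simp) j (by simp [hj]) (by rintro rfl; exact his hj)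

theorem packs_one_of_card_three {G : SimpleGraph V} {R : Finset V} (hR : R.card = 3)
    (h : ∀ v ∈ R, ∃ w ∈ R, G.Adj v w) : Packs G R 1 := by
  obtain ⟨a, b, c, hab, hac, hbc, rfl⟩ := Finset.card_eq_three.1 hR
  have key : ∀ {p q r}, G.Adj p q → G.Adj q r → p ≠ r → p ∈ ({a, b, c} : Finset V) →
      q ∈ ({a, b, c} : Finset V) → r ∈ ({a, b, c} : Finset V) → Packs G {a, b, c} 1 :=
    fun h1 h2 h3 h4 h5 h6 => packs_one h1 h2 h3 h4 h5 h6
  have ha := h a (by simp)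
  have hb := h b (by simp)
  have hc := h c (by simp)
  simp only [Finset.mem_insert, Finset.mem_singleton, exists_eq_or_imp, exists_eq_left,
    SimpleGraph.irrefl, false_or, or_false] at ha hb hc
  have hor : (G.Adj a b ∧ G.Adj b c) ∨ (G.Adj a c ∧ G.Adj c b) ∨ (G.Adj b a ∧ G.Adj a c) := by
    have := G.adj_comm a b
    have := G.adj_comm a c
    have := G.adj_comm c b
    tauto
  rcases hor with h | h | h
  · exact key h.1 h.2 hac (by simp) (by simp) (by simp)
  · exact key h.1 h.2 hab (by simp) (by simp) (by simp)
  · exact key h.1 h.2 hbc (by simp) (by simp) (by simp)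

/-- Every degree is `0`, `2` or `3`, and no five vertices of positive degree are closed
under adjacency. -/
structure Good (G : SimpleGraph V) : Prop where
  deg : ∀ v, (nb G v).card = 0 ∨ (nb G v).card = 2 ∨ (nb G v).card = 3
  five : ∀ A : Finset V, A.card = 5 → A ⊆ posVerts G →
    ∃ u ∈ A, ∃ w, w ∉ A ∧ G.Adj u w

/-- Remove all edges meeting `R`. -/
def del (G : SimpleGraph V) (R : Finset V) : SimpleGraph V where
  Adj u v := G.Adj u v ∧ u ∉ R ∧ v ∉ R
  symm := ⟨fun _ _ h => ⟨h.1.symm, h.2.2, h.2.1⟩⟩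
  loopless := ⟨fun _ h => G.irrefl h.1⟩

/-- A counterexample with the fewest edges. -/
structure Critical (G : SimpleGraph V) : Prop where
  good : Good G
  ih : ∀ G' : SimpleGraph V, Good G' → ∑ v, (nb G' v).card < ∑ v, (nb G v).card →
    ∃ k, Packs G' Finset.univ k ∧ (posVerts G').card ≤ 4 * k
  none : ∀ k, Packs G Finset.univ k → 4 * k < (posVerts G).card

/-- `A` has five vertices and a single edge `xy` leaves it. -/
structure Pend (G : SimpleGraph V) (A : Finset V) (x y : V) : Prop where
  card : A.card = 5
  sub : A ⊆ posVerts G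
  hx : x ∈ A
  hy : y ∉ A
  adj : G.Adj x y
  out : ∀ u ∈ A, ∀ w, w ∉ A → G.Adj u w → u = x ∧ w = y

theorem mem_posVerts_of_adj {G : SimpleGraph V} {u v : V} (h : G.Adj u v) : u ∈ posVerts G := by
  rw [mem_posVerts, ← Nat.pos_iff_ne_zero, Finset.card_pos]
  exact ⟨v, mem_nb.2 h⟩

theorem exists_adj_ne {G : SimpleGraph V} (hG : Good G) {v : V} (hv : v ∈ posVerts G) (a : V) :
    ∃ b, b ≠ a ∧ G.Adj v b := by
  rw [mem_posVerts] at hv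
  have : 1 < (nb G v).card := by have := hG.deg v; omega
  obtain ⟨b, hb, hba⟩ := Finset.exists_mem_ne this a
  exact ⟨b, hba, mem_nb.1 hb⟩

theorem exists_adj_two {G : SimpleGraph V} (hG : Good G) {v : V} (hv : v ∈ posVerts G) :
    ∃ a b, a ≠ b ∧ G.Adj v a ∧ G.Adj v b := by
  obtain ⟨a, -, ha⟩ := exists_adj_ne hG hv v
  obtain ⟨b, hb, hb'⟩ := exists_adj_ne hG hv a
  exact ⟨a, b, hb.symm, ha, hb'⟩

theorem exists_of_nb_card_two {G : SimpleGraph V} {v a : V} (h : (nb G v).card = 2)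
    (ha : G.Adj v a) : ∃ b, b ≠ a ∧ G.Adj v b ∧ ∀ w, G.Adj v w → w = a ∨ w = b := by
  obtain ⟨p, q, hpq, hn⟩ := Finset.card_eq_two.1 h
  have hm : ∀ w, G.Adj v w ↔ w = p ∨ w = q := fun w => by
    rw [← mem_nb, hn]; simp
  rcases (hm a).1 ha with rfl | rfl
  · exact ⟨q, by grind⟩
  · exact ⟨p, by grind⟩

theorem exists_of_nb_card_three {G : SimpleGraph V} {v a : V} (h : (nb G v).card = 3)
    (ha : G.Adj v a) : ∃ b c, b ≠ a ∧ c ≠ a ∧ b ≠ c ∧ G.Adj v b ∧ G.Adj v c ∧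
      ∀ w, G.Adj v w → w = a ∨ w = b ∨ w = c := by
  obtain ⟨p, q, r, hpq, hpr, hqr, hn⟩ := Finset.card_eq_three.1 h
  have hm : ∀ w, G.Adj v w ↔ w = p ∨ w = q ∨ w = r := fun w => by
    rw [← mem_nb, hn]; simp
  rcases (hm a).1 ha with rfl | rfl | rfl
  · exact ⟨q, r, by grind⟩
  · exact ⟨p, r, by grind⟩
  · exact ⟨p, q, by grind⟩

theorem three_le_of_pos {G : SimpleGraph V} (hG : Good G) {X : Finset V} {v : V} (hv : v ∈ X)
    (hvp : v ∈ posVerts G) (h : ∀ w, G.Adj v w → w ∈ X) : 3 ≤ X.card := by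
  obtain ⟨a, b, hab, ha, hb⟩ := exists_adj_two hG hvp
  have hs : ({v, a, b} : Finset V) ⊆ X := by
    simp [Finset.insert_subset_iff, hv, h _ ha, h _ hb]
  rw [← Finset.card_eq_three.2 ⟨v, a, b, ha.ne, hb.ne, hab, rfl⟩]
  exact Finset.card_le_card hs

theorem three_le_card {G : SimpleGraph V} (hG : Good G) {X : Finset V} (hX : X ⊆ posVerts G)
    (hne : X.Nonempty) (p q : V) (h : ∀ u ∈ X, ∀ w, w ∉ X → G.Adj u w → u = p ∧ w = q) :
    3 ≤ X.card := by
  by_cases hp : ∃ v ∈ X, v ≠ p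
  · obtain ⟨v, hv, hvp⟩ := hp
    refine three_le_of_pos hG hv (hX hv) fun w hw => ?_
    by_contra hwX
    exact hvp (h v hv w hwX hw).1
  · push Not at hp
    obtain ⟨v, hv⟩ := hne
    obtain ⟨b, hbq, hb⟩ := exists_adj_ne hG (hX hv) q
    by_cases hbX : b ∈ X
    · exact absurd ((hp v hv).trans (hp b hbX).symm) hb.ne
    · exact absurd (h v hv b hbX hb).2 hbq

theorem Packs.of_del {G : SimpleGraph V} {R : Finset V} {k : ℕ}
    (h : Packs (del G R) Finset.univ k) : Packs G Rᶜ k := by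
  obtain ⟨P, hP, hk, hPR⟩ := h
  refine ⟨P, ⟨fun p hp => ?_, hP.2⟩, hk, fun p hp => ?_⟩
  · obtain ⟨a, b, c, d, e⟩ := hP.1 p hp
    exact ⟨a, b, c, d.1, e.1⟩
  · obtain ⟨a, b, c, d, e⟩ := hP.1 p hp
    simp [pVerts, Set.insert_subset_iff, d.2.1, d.2.2, e.2.2]

theorem posVerts_del_subset {G : SimpleGraph V} {R : Finset V} :
    posVerts (del G R) ⊆ posVerts G \ R := by
  intro v hv
  rw [mem_posVerts, ← Nat.pos_iff_ne_zero, Finset.card_pos] at hv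
  obtain ⟨w, hw⟩ := hv
  rw [mem_nb] at hw
  exact Finset.mem_sdiff.2 ⟨mem_posVerts_of_adj hw.1, hw.2.1⟩

theorem sum_nb_lt {G G' : SimpleGraph V} (h : ∀ v, (nb G' v).card ≤ (nb G v).card) (u : V)
    (hu : (nb G' u).card < (nb G u).card) : ∑ v, (nb G' v).card < ∑ v, (nb G v).card :=
  Finset.sum_lt_sum (fun v _ => h v) ⟨u, Finset.mem_univ _, hu⟩

theorem Critical.del_false {G : SimpleGraph V} (hG : Critical G) {R : Finset V}
    (hR : (R ∩ posVerts G).Nonempty) (hd : Good (del G R))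
    (hpos : posVerts G \ R ⊆ posVerts (del G R)) {k : ℕ} (hk : Packs G R k)
    (hc : R.card ≤ 4 * k) : False := by
  have hsub : ∀ v, nb (del G R) v ⊆ nb G v := fun v w hw => by
    rw [mem_nb] at hw ⊢; exact hw.1
  obtain ⟨r, hr⟩ := hR
  rw [Finset.mem_inter, mem_posVerts] at hr
  have hr0 : (nb (del G R) r).card = 0 := by
    rw [Finset.card_eq_zero, Finset.eq_empty_iff_forall_notMem]
    intro w hw
    rw [mem_nb] at hw
    exact hw.2.1 hr.1
  obtain ⟨k', hk', hc'⟩ := hG.ih _ hd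
    (sum_nb_lt (fun v => Finset.card_le_card (hsub v)) r (by omega))
  have h1 := hG.none _ (hk.add hk'.of_del disjoint_compl_right (Finset.subset_univ _))
  have h2 := Finset.card_le_card hpos
  have h3 := Finset.le_card_sdiff R (posVerts G)
  omega

theorem nb_del_of_closed {G : SimpleGraph V} {R : Finset V} {v : V} (hv : v ∉ R)
    (h : ∀ w, G.Adj v w → w ∉ R) : nb (del G R) v = nb G v := by
  ext w
  rw [mem_nb, mem_nb]
  exact ⟨fun h => h.1, fun h' => ⟨h', hv, h w h'⟩⟩

theorem nb_del_of_mem {G : SimpleGraph V} {R : Finset V} {v : V} (hv : v ∈ R) :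
    nb (del G R) v = ∅ := by
  ext w
  rw [mem_nb]
  simp only [Finset.notMem_empty, iff_false]
  exact fun h => h.2.1 hv

theorem Critical.closed {G : SimpleGraph V} (hG : Critical G) {R : Finset V}
    (hne : R.Nonempty) (hR : R ⊆ posVerts G) (hcl : ∀ u ∈ R, ∀ w, G.Adj u w → w ∈ R)
    {k : ℕ} (hk : Packs G R k) (hc : R.card ≤ 4 * k) : False := by
  have hnb : ∀ v, v ∉ R → nb (del G R) v = nb G v := fun v hv =>
    nb_del_of_closed hv fun w hw hwR => hv (hcl w hwR v hw.symm)
  refine hG.del_false (by rwa [Finset.inter_eq_left.2 hR]) ⟨fun v => ?_, fun A hA hAp => ?_⟩ ?_ hk hc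
  · by_cases hv : v ∈ R
    · simp [nb_del_of_mem hv]
    · rw [hnb v hv]; exact hG.good.deg v
  · have hA' := hAp.trans posVerts_del_subset
    obtain ⟨u, hu, w, hw, huw⟩ := hG.good.five A hA (hA'.trans Finset.sdiff_subset)
    have huR := (Finset.mem_sdiff.1 (hA' hu)).2
    exact ⟨u, hu, w, hw, huw, huR, fun hwR => huR (hcl w hwR u huw.symm)⟩
  · intro v hv
    rw [Finset.mem_sdiff] at hv
    rw [mem_posVerts, hnb v hv.2]
    exact mem_posVerts.1 hv.1

theorem packs_of_pos {G : SimpleGraph V} (hG : Good G) {R : Finset V} {v : V} (hv : v ∈ R)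
    (hvp : v ∈ posVerts G) (h : ∀ w, G.Adj v w → w ∈ R) : Packs G R 1 := by
  obtain ⟨a, b, hab, ha, hb⟩ := exists_adj_two hG hvp
  exact packs_one ha.symm hb hab (h a ha) hv (h b hb)

theorem Critical.one_out {G : SimpleGraph V} (hG : Critical G) {R : Finset V} {r z : V}
    (hr : r ∈ R) (hz : z ∉ R) (hR : R ⊆ posVerts G) (hrz : G.Adj r z)
    (hout : ∀ u ∈ R, ∀ w, w ∉ R → G.Adj u w → u = r ∧ w = z) (hz3 : (nb G z).card = 3)
    {k : ℕ} (hk : Packs G R k) (hc : R.card + 1 ≤ 4 * k) : False := by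
  have hnb : ∀ v, v ∉ R → v ≠ z → nb (del G R) v = nb G v := fun v hv hvz =>
    nb_del_of_closed hv fun w hw hwR => hvz (hout w hwR v hv hw.symm).2
  have hnz : nb (del G R) z = (nb G z).erase r := by
    ext w
    rw [mem_nb, Finset.mem_erase, mem_nb]
    constructor
    · exact fun h => ⟨by rintro rfl; exact h.2.2 hr, h.1⟩
    · exact fun h => ⟨h.2, hz, fun hw => h.1 (hout w hw z hz h.2.symm).1⟩
  have hnz2 : (nb (del G R) z).card = 2 := by
    rw [hnz, Finset.card_erase_of_mem (by simpa using hrz.symm), hz3]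
  have hdeg : ∀ v, (nb (del G R) v).card = 0 ∨ (nb (del G R) v).card = 2 ∨
      (nb (del G R) v).card = 3 := fun v => by
    by_cases hv : v ∈ R
    · simp [nb_del_of_mem hv]
    · by_cases hvz : v = z
      · rw [hvz, hnz2]; simp
      · rw [hnb v hv hvz]; exact hG.good.deg v
  by_cases hfive : ∀ A : Finset V, A.card = 5 → A ⊆ posVerts (del G R) →
      ∃ u ∈ A, ∃ w, w ∉ A ∧ (del G R).Adj u w
  · refine hG.del_false (R := R) ⟨r, by simp [hr, hR hr]⟩ ⟨hdeg, hfive⟩ ?_ hk (by omega)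
    intro v hv
    rw [Finset.mem_sdiff] at hv
    by_cases hvz : v = z
    · rw [hvz, mem_posVerts, hnz2]; simp
    · rw [mem_posVerts, hnb v hv.2 hvz]
      exact mem_posVerts.1 hv.1
  · push Not at hfive
    obtain ⟨A, hA, hAp, hAc⟩ := hfive
    have hA' := hAp.trans posVerts_del_subset
    have hAR : Disjoint R A := by
      rw [Finset.disjoint_right]
      exact fun v hv => (Finset.mem_sdiff.1 (hA' hv)).2
    have hzA : z ∈ A := by
      by_contra hzA
      obtain ⟨u, hu, w, hw, huw⟩ := hG.good.five A hA (hA'.trans Finset.sdiff_subset)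
      have huR := (Finset.mem_sdiff.1 (hA' hu)).2
      refine hAc u hu w hw ⟨huw, huR, fun hwR => ?_⟩
      exact hzA ((hout w hwR u huR huw.symm).2 ▸ hu)
    obtain ⟨a, b, hab, hn⟩ := Finset.card_eq_two.1 hnz2
    have ha : (del G R).Adj z a := mem_nb.1 (by simp [hn])
    have hb : (del G R).Adj z b := mem_nb.1 (by simp [hn])
    have hmem : ∀ w, (del G R).Adj z w → w ∈ A := fun w hw => by
      by_contra hwA
      exact hAc z hzA w hwA hw
    have hp : Packs G A 1 := packs_one ha.1.symm hb.1 hab (hmem a ha) hzA (hmem b hb)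
    refine hG.closed (R := R ∪ A) ⟨r, by simp [hr]⟩
      (Finset.union_subset hR (hA'.trans Finset.sdiff_subset)) ?_ (hk.union hp hAR) ?_
    · intro u hu w huw
      rw [Finset.mem_union] at hu ⊢
      by_contra! hw
      rcases hu with hu | hu
      · exact hw.2 ((hout u hu w hw.1 huw).2 ▸ hzA)
      · exact hAc u hu w hw.2 ⟨huw, Finset.disjoint_right.1 hAR hu, hw.1⟩
    · rw [Finset.card_union_of_disjoint hAR, hA]; omega

/-- Remove the edge `bc`. -/
def delEdge (G : SimpleGraph V) (b c : V) : SimpleGraph V where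
  Adj u v := G.Adj u v ∧ ¬(u = b ∧ v = c) ∧ ¬(u = c ∧ v = b)
  symm := ⟨fun _ _ h => ⟨h.1.symm, fun h' => h.2.2 h'.symm, fun h' => h.2.1 h'.symm⟩⟩
  loopless := ⟨fun _ h => G.irrefl h.1⟩

theorem delEdge_comm (G : SimpleGraph V) (b c : V) : delEdge G b c = delEdge G c b := by
  ext u v
  simp only [delEdge]
  tauto

theorem nb_delEdge_left (G : SimpleGraph V) {b c : V} (h : b ≠ c) :
    nb (delEdge G b c) b = (nb G b).erase c := by
  ext w
  rw [mem_nb, Finset.mem_erase, mem_nb]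
  simp only [delEdge]
  grind

theorem nb_delEdge_of_ne (G : SimpleGraph V) {b c v : V} (hb : v ≠ b) (hc : v ≠ c) :
    nb (delEdge G b c) v = nb G v := by
  ext w
  rw [mem_nb, mem_nb]
  simp [delEdge, hb, hc]

theorem Critical.pend_of_adj {G : SimpleGraph V} (hG : Critical G) {b c : V} (hbc : G.Adj b c)
    (hb : (nb G b).card = 3) (hc : (nb G c).card = 3) :
    ∃ A, Pend G A b c ∨ Pend G A c b := by
  have hb' : (nb (delEdge G b c) b).card = 2 := by
    rw [nb_delEdge_left G hbc.ne, Finset.card_erase_of_mem (mem_nb.2 hbc), hb]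
  have hc' : (nb (delEdge G b c) c).card = 2 := by
    rw [delEdge_comm, nb_delEdge_left G hbc.ne.symm,
      Finset.card_erase_of_mem (mem_nb.2 hbc.symm), hc]
  have ho : ∀ v, v ≠ b → v ≠ c → nb (delEdge G b c) v = nb G v :=
    fun v => nb_delEdge_of_ne G
  have hpos : posVerts (delEdge G b c) = posVerts G := by
    ext v
    rw [mem_posVerts, mem_posVerts]
    by_cases h1 : v = b
    · subst h1; rw [hb', hb]; simp
    · by_cases h2 : v = c
      · subst h2; rw [hc', hc]; simp
      · rw [ho v h1 h2]
  by_cases hfive : ∀ A : Finset V, A.card = 5 → A ⊆ posVerts (delEdge G b c) →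
      ∃ u ∈ A, ∃ w, w ∉ A ∧ (delEdge G b c).Adj u w
  · have hgood : Good (delEdge G b c) := by
      refine ⟨fun v => ?_, hfive⟩
      by_cases h1 : v = b
      · subst h1; rw [hb']; simp
      · by_cases h2 : v = c
        · subst h2; rw [hc']; simp
        · rw [ho v h1 h2]; exact hG.good.deg v
    obtain ⟨k, hk, hkc⟩ := hG.ih _ hgood (sum_nb_lt (fun v => Finset.card_le_card fun w hw => by
      rw [mem_nb] at hw ⊢; exact hw.1) b (by omega))
    have := hG.none k (hk.mono subset_rfl fun _ _ _ _ h => h.1)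
    rw [hpos] at hkc
    omega
  · push Not at hfive
    obtain ⟨A, hA, hAp, hAc⟩ := hfive
    rw [hpos] at hAp
    obtain ⟨u, hu, w, hw, huw⟩ := hG.good.five A hA hAp
    have key : ∀ u ∈ A, ∀ w, w ∉ A → G.Adj u w → (u = b ∧ w = c) ∨ (u = c ∧ w = b) := by
      intro u hu w hw huw
      by_contra! h
      exact hAc u hu w hw ⟨huw, fun h' => h.1 h'.1 h'.2, fun h' => h.2 h'.1 h'.2⟩
    refine ⟨A, ?_⟩
    rcases key u hu w hw huw with ⟨rfl, rfl⟩ | ⟨rfl, rfl⟩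
    · refine Or.inl ⟨hA, hAp, hu, hw, huw, fun u' hu' w' hw' h' => ?_⟩
      rcases key u' hu' w' hw' h' with h | h
      · exact h
      · exact absurd (h.1 ▸ hu') hw
    · refine Or.inr ⟨hA, hAp, hu, hw, huw, fun u' hu' w' hw' h' => ?_⟩
      rcases key u' hu' w' hw' h' with h | h
      · exact absurd (h.1 ▸ hu') hw
      · exact h

/-- Isolate the vertices of `R` and add the edge `xy`. -/
def bypass (G : SimpleGraph V) (R : Finset V) {x y : V} (hxy : x ≠ y) : SimpleGraph V where
  Adj u v := (G.Adj u v ∧ u ∉ R ∧ v ∉ R) ∨ (u = x ∧ v = y) ∨ (u = y ∧ v = x)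
  symm := ⟨fun _ _ h => h.elim (fun h => Or.inl ⟨h.1.symm, h.2.2, h.2.1⟩)
    fun h => Or.inr (h.symm.imp And.symm And.symm)⟩
  loopless := ⟨fun _ h => by
    rcases h with h | h | h
    · exact G.irrefl h.1
    · exact hxy (h.1.symm.trans h.2)
    · exact hxy (h.2.symm.trans h.1)⟩

theorem packs_two_of_bypass {G : SimpleGraph V} {s₁ s₂ s₃ x y a b c : V} (hxy : x ≠ y)
    (h12 : G.Adj s₁ s₂) (h23 : G.Adj s₂ s₃) (h13 : s₁ ≠ s₃) (hx : G.Adj x s₁) (hy : G.Adj y s₃)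
    (hxR : x ∉ ({s₁, s₂, s₃} : Finset V)) (hyR : y ∉ ({s₁, s₂, s₃} : Finset V))
    (hp : IsPathL (bypass G {s₁, s₂, s₃} hxy) (a, b, c)) (hn : ¬ IsPathL G (a, b, c)) :
    (a ∉ ({s₁, s₂, s₃} : Finset V) ∧ b ∉ ({s₁, s₂, s₃} : Finset V) ∧
      c ∉ ({s₁, s₂, s₃} : Finset V)) ∧ x ∈ ({a, b, c} : Finset V) ∧ y ∈ ({a, b, c} : Finset V) ∧
      Packs G ({a, b, c} ∪ {s₁, s₂, s₃}) 2 := by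
  have two : ∀ {p₁ p₂ p₃ q₁ q₂ q₃ : V}, G.Adj p₁ p₂ → G.Adj p₂ p₃ → p₁ ≠ p₃ →
      G.Adj q₁ q₂ → G.Adj q₂ q₃ → q₁ ≠ q₃ → Disjoint ({p₁, p₂, p₃} : Finset V) {q₁, q₂, q₃} →
      ({p₁, p₂, p₃} : Finset V) ∪ {q₁, q₂, q₃} ⊆ {a, b, c} ∪ {s₁, s₂, s₃} →
      Packs G ({a, b, c} ∪ {s₁, s₂, s₃}) 2 := fun h1 h2 h3 h4 h5 h6 h7 h8 =>
    (packs_one h1 h2 h3 (by simp) (by simp) (by simp)).add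
      (packs_one h4 h5 h6 (by simp) (by simp) (by simp)) h7 h8
  have n12 := h12.ne
  have n23 := h23.ne
  simp only [Finset.mem_insert, Finset.mem_singleton, not_or] at hxR hyR
  simp only [IsPathL, bypass, Finset.mem_insert, Finset.mem_singleton, not_or] at hp hn
  obtain ⟨hab, hbc, hac, h1, h2⟩ := hp
  rcases h1 with h1 | ⟨rfl, rfl⟩ | ⟨rfl, rfl⟩ <;> rcases h2 with h2 | ⟨h5, h6⟩ | ⟨h3, h4⟩
  · exact absurd ⟨hab, hbc, hac, h1.1, h2.1⟩ hn
  · subst h5 h6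
    refine ⟨by simp [hxR, hyR, h1.2.1], by simp, by simp, ?_⟩
    exact two h1.1 hx (by tauto) h23 hy.symm (by tauto)
      (by rw [Finset.disjoint_left]; simp; grind) (by intro z; simp; grind)
  · subst h3 h4
    refine ⟨by simp [hxR, hyR, h1.2.1], by simp, by simp, ?_⟩
    exact two h1.1 hy (by tauto) h12.symm hx.symm (by tauto)
      (by rw [Finset.disjoint_left]; simp; grind) (by intro z; simp; grind)
  · refine ⟨by simp [hxR, hyR, h2.2.2], by simp, by simp, ?_⟩
    exact two h2.1.symm hy (by tauto) h12.symm hx.symm (by tauto)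
      (by rw [Finset.disjoint_left]; simp; grind) (by intro z; simp; grind)
  · exact absurd h5.symm hab
  · exact absurd h4.symm hac
  · refine ⟨by simp [hxR, hyR, h2.2.2], by simp, by simp, ?_⟩
    exact two h2.1.symm hx (by tauto) h23 hy.symm (by tauto)
      (by rw [Finset.disjoint_left]; simp; grind) (by intro z; simp; grind)
  · exact absurd h6.symm hac
  · exact absurd h3.symm hab

theorem Critical.no_bypass {G : SimpleGraph V} (hG : Critical G) {s₁ s₂ s₃ x y : V}
    (h12 : G.Adj s₁ s₂) (h23 : G.Adj s₂ s₃) (h13 : s₁ ≠ s₃) (hx : G.Adj x s₁) (hy : G.Adj y s₃)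
    (hxR : x ∉ ({s₁, s₂, s₃} : Finset V)) (hyR : y ∉ ({s₁, s₂, s₃} : Finset V))
    (hxy : x ≠ y) (hna : ¬ G.Adj x y) (hs1 : ∀ w, G.Adj s₁ w → w = x ∨ w = s₂)
    (hs2 : ∀ w, G.Adj s₂ w → w = s₁ ∨ w = s₃)
    (hs3 : ∀ w, G.Adj s₃ w → w = y ∨ w = s₂) : False := by
  obtain ⟨R, hR⟩ : ∃ R : Finset V, R = {s₁, s₂, s₃} := ⟨_, rfl⟩
  have hRm : ∀ w, w ∈ R ↔ w = s₁ ∨ w = s₂ ∨ w = s₃ := fun w => by simp [hR]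
  have hxR' : x ∉ R := hR ▸ hxR
  have hyR' : y ∉ R := hR ▸ hyR
  have hRc : ∀ r ∈ R, ∀ w, G.Adj r w → w ∉ R → w = x ∨ w = y := by
    intro r hr w hw hwR
    rw [hRm] at hr hwR
    rcases hr with rfl | rfl | rfl
    · have := hs1 w hw; tauto
    · have := hs2 w hw; tauto
    · have := hs3 w hw; tauto
  have hR1 : Packs G R 1 := packs_one h12 h23 h13 (by simp [hR]) (by simp [hR]) (by simp [hR])
  have hR3 : R.card = 3 := by rw [hR]; exact Finset.card_eq_three.2 ⟨_, _, _, h12.ne, h13, h23.ne, rfl⟩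
  have hRp : R ⊆ posVerts G := by
    intro r hr
    rw [hRm] at hr
    rcases hr with rfl | rfl | rfl
    · exact mem_posVerts_of_adj h12
    · exact mem_posVerts_of_adj h23
    · exact mem_posVerts_of_adj h23.symm
  set G' := bypass G R hxy with hG'
  have hadj : ∀ u v, G'.Adj u v ↔ (G.Adj u v ∧ u ∉ R ∧ v ∉ R) ∨ (u = x ∧ v = y) ∨ (u = y ∧ v = x) :=
    fun _ _ => Iff.rfl
  have nx : nb G' x = insert y ((nb G x).erase s₁) := by
    ext w
    rw [mem_nb, hadj, Finset.mem_insert, Finset.mem_erase, mem_nb]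
    have : G.Adj x w → w ∈ R → w = s₁ := by
      intro h hw
      rw [hRm] at hw hxR'
      rcases hw with rfl | rfl | rfl
      · rfl
      · have := hs2 x h.symm; tauto
      · have := hs3 x h.symm; tauto
    have h1 : s₁ ∈ R := by simp [hR]
    grind
  have ny : nb G' y = insert x ((nb G y).erase s₃) := by
    ext w
    rw [mem_nb, hadj, Finset.mem_insert, Finset.mem_erase, mem_nb]
    have : G.Adj y w → w ∈ R → w = s₃ := by
      intro h hw
      rw [hRm] at hw hyR'
      rcases hw with rfl | rfl | rfl
      · have := hs1 y h.symm; tauto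
      · have := hs2 y h.symm; tauto
      · rfl
    have h1 : s₃ ∈ R := by simp [hR]
    grind
  have cx : (nb G' x).card = (nb G x).card := by
    rw [nx, Finset.card_insert_of_notMem (by simp [hna]),
      Finset.card_erase_add_one (mem_nb.2 hx)]
  have cy : (nb G' y).card = (nb G y).card := by
    rw [ny, Finset.card_insert_of_notMem (by simp [G.adj_comm y x, hna]),
      Finset.card_erase_add_one (mem_nb.2 hy)]
  have no : ∀ v, v ∉ R → v ≠ x → v ≠ y → nb G' v = nb G v := by
    intro v hv hvx hvy
    ext w
    rw [mem_nb, mem_nb, hadj]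
    have : G.Adj v w → w ∉ R := fun h hw => by
      have := hRc w hw v h.symm hv
      tauto
    tauto
  have nR : ∀ v ∈ R, nb G' v = ∅ := by
    intro v hv
    rw [Finset.eq_empty_iff_forall_notMem]
    intro w hw
    rw [mem_nb, hadj] at hw
    rcases hw with h | ⟨rfl, -⟩ | ⟨rfl, -⟩ <;> tauto
  have co : ∀ v, v ∉ R → (nb G' v).card = (nb G v).card := by
    intro v hv
    by_cases h1 : v = x
    · rw [h1, cx]
    · by_cases h2 : v = y
      · rw [h2, cy]
      · rw [no v hv h1 h2]
  have hpos : posVerts G' = posVerts G \ R := by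
    ext v
    rw [Finset.mem_sdiff, mem_posVerts, mem_posVerts]
    by_cases hv : v ∈ R
    · simp [nR v hv, hv]
    · simp [co v hv, hv]
  have hgood : Good G' := by
    refine ⟨fun v => ?_, fun A hA hAp => ?_⟩
    · by_cases hv : v ∈ R
      · simp [nR v hv]
      · rw [co v hv]; exact hG.good.deg v
    by_contra! hAc
    rw [hpos] at hAp
    have hAG := hAp.trans Finset.sdiff_subset
    have hAR : Disjoint R A := by
      rw [Finset.disjoint_right]
      exact fun v hv => (Finset.mem_sdiff.1 (hAp hv)).2
    have hxyA : x ∈ A ↔ y ∈ A := by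
      constructor
      · intro h
        by_contra h'
        exact hAc x h y h' (by simp [hadj])
      · intro h
        by_contra h'
        exact hAc y h x h' (by simp [hadj])
    by_cases hxA : x ∈ A
    · have hyA := hxyA.1 hxA
      obtain ⟨p, hp, hp'⟩ : ∃ p ∈ A, p ∉ ({x, y} : Finset V) :=
        Finset.exists_mem_notMem_of_card_lt_card (by
          have := Finset.card_le_two (a := x) (b := y)
          omega)
      simp only [Finset.mem_insert, Finset.mem_singleton, not_or] at hp'
      have hA1 : Packs G A 1 := by
        refine packs_of_pos hG.good hp (hAG hp) fun w hw => ?_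
        by_contra hwA
        refine hAc p hp w hwA ?_
        rw [← mem_nb, no p (Finset.disjoint_right.1 hAR hp) hp'.1 hp'.2, mem_nb]
        exact hw
      refine hG.closed (R := R ∪ A) ⟨x, by simp [hxA]⟩ (Finset.union_subset hRp hAG) ?_
        (hR1.union hA1 hAR) (by rw [Finset.card_union_of_disjoint hAR]; omega)
      intro u hu w huw
      rw [Finset.mem_union] at hu ⊢
      by_contra! hw
      rcases hu with hu | hu
      · rcases hRc u hu w huw hw.1 with rfl | rfl <;> tauto
      · exact hAc u hu w hw.2 ((hadj _ _).2 (Or.inl ⟨huw, Finset.disjoint_right.1 hAR hu, hw.1⟩))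
    · have hyA := mt hxyA.2 hxA
      obtain ⟨u, hu, w, hw, huw⟩ := hG.good.five A hA hAG
      have huR := Finset.disjoint_right.1 hAR hu
      refine hAc u hu w hw ((hadj _ _).2 (Or.inl ⟨huw, huR, fun hwR => ?_⟩))
      rcases hRc w hwR u huw.symm huR with rfl | rfl <;> tauto
  obtain ⟨k, ⟨P, hP, hPk, -⟩, hkc⟩ := hG.ih G' hgood (sum_nb_lt (fun v => by
    by_cases hv : v ∈ R
    · simp [nR v hv]
    · exact (co v hv).le) s₁ (by
      rw [nR s₁ (by simp [hR]), Finset.card_empty, Finset.card_pos]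
      exact ⟨s₂, mem_nb.2 h12⟩))
  have hcard : (posVerts G).card ≤ 4 * k + 3 := by
    rw [hpos] at hkc
    have := Finset.le_card_sdiff R (posVerts G)
    omega
  suffices h : Packs G Finset.univ (k + 1) by
    have := hG.none _ h
    omega
  have hPR : ∀ p ∈ P, ∀ v ∈ pVerts p, v ∉ R := by
    intro p hp v hv hvR
    obtain ⟨-, -, -, h1, h2⟩ := hP.1 p hp
    have hiso : ∀ w, ¬ G'.Adj v w := fun w hw => by
      have := mem_nb.2 hw
      rw [nR v hvR] at this
      simp at this
    simp only [pVerts, Set.mem_insert_iff, Set.mem_singleton_iff] at hv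
    rcases hv with rfl | rfl | rfl
    · exact hiso _ h1
    · exact hiso _ h2
    · exact hiso _ h2.symm
  by_cases hall : ∀ p ∈ P, IsPathL G p
  · have : Packs G Rᶜ k := ⟨P, ⟨hall, hP.2⟩, hPk, fun p hp v hv => by
      simpa using hPR p hp v hv⟩
    exact this.add hR1 disjoint_compl_left (Finset.subset_univ _)
  · push Not at hall
    obtain ⟨⟨a, b, c⟩, hp, hnp⟩ := hall
    obtain ⟨-, hxp, hyp, h2⟩ := packs_two_of_bypass hxy h12 h23 h13 hx hy hxR hyR
      (by rw [← hR]; exact hP.1 _ hp) hnp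
    rw [← hR] at h2
    have hrest : Packs G ({a, b, c} ∪ R)ᶜ (k - 1) := by
      refine ⟨P.erase (a, b, c), ⟨fun q hq => ?_, fun q hq q' hq' =>
        hP.2 q (Finset.mem_of_mem_erase hq) q' (Finset.mem_of_mem_erase hq')⟩,
        by rw [Finset.card_erase_of_mem hp, hPk], fun q hq v hv => ?_⟩
      · rw [Finset.mem_erase] at hq
        have hd := hP.2 q hq.2 _ hp hq.1
        have hqx : ∀ v ∈ pVerts q, v ≠ x ∧ v ≠ y := by
          intro v hv
          have := Set.disjoint_left.1 hd hv
          simp only [pVerts, Set.mem_insert_iff, Set.mem_singleton_iff] at this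
          simp only [Finset.mem_insert, Finset.mem_singleton] at hxp hyp
          constructor <;> rintro rfl <;> tauto
        obtain ⟨g1, g2, g3, g4, g5⟩ := hP.1 q hq.2
        rw [hadj] at g4 g5
        have q1 := hqx q.1 (by simp [pVerts])
        have q2 := hqx q.2.1 (by simp [pVerts])
        exact ⟨g1, g2, g3, by tauto, by tauto⟩
      · rw [Finset.mem_erase] at hq
        have hd := Set.disjoint_left.1 (hP.2 q hq.2 _ hp hq.1) hv
        have := hPR q hq.2 v hv
        simp only [pVerts, Set.mem_insert_iff, Set.mem_singleton_iff] at hd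
        simp only [Finset.mem_coe, Finset.mem_compl, Finset.mem_union, Finset.mem_insert,
          Finset.mem_singleton]
        tauto
    have hk1 : 1 ≤ k := by
      rw [← hPk]; exact Finset.card_pos.2 ⟨_, hp⟩
    have := hrest.add h2 disjoint_compl_left (Finset.subset_univ _)
    rwa [show k - 1 + 2 = k + 1 by omega] at this

theorem Pend.mem {G : SimpleGraph V} {A : Finset V} {x y : V} (h : Pend G A x y) {u w : V}
    (hu : u ∈ A) (huw : G.Adj u w) (hux : u ≠ x) : w ∈ A := by
  by_contra hw
  exact hux (h.out u hu w hw huw).1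

theorem Pend.mem_of_ne {G : SimpleGraph V} {A : Finset V} {x y : V} (h : Pend G A x y) {u w : V}
    (hu : u ∈ A) (huw : G.Adj u w) (hwy : w ≠ y) : w ∈ A := by
  by_contra hw
  exact hwy (h.out u hu w hw huw).2

theorem Pend.packs {G : SimpleGraph V} (hG : Good G) {A : Finset V} {x y : V}
    (h : Pend G A x y) : ∃ u ∈ A, G.Adj x u ∧ Packs G (A \ {x, u}) 1 := by
  obtain ⟨u, huy, hxu⟩ := exists_adj_ne hG (h.sub h.hx) y
  have hu := h.mem_of_ne h.hx hxu huy
  have hcard : ∀ z ∈ A, z ≠ x → (A \ {x, z}).card = 3 := by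
    intro z hz hzx
    have hs : ({x, z} : Finset V) ⊆ A := by simp [Finset.insert_subset_iff, h.hx, hz]
    rw [Finset.card_sdiff_of_subset hs, Finset.card_pair hzx.symm, h.card]
  by_cases hu' : ∃ u' ∈ A, u' ≠ u ∧ G.Adj x u'
  · obtain ⟨u', hu', huu, hxu'⟩ := hu'
    have hu'y : u' ≠ y := by rintro rfl; exact h.hy hu'
    have hx3 : ∀ w, G.Adj x w → w = u ∨ w = u' ∨ w = y := by
      have hsub : ({u, u', y} : Finset V) ⊆ nb G x := by
        simp [Finset.insert_subset_iff, hxu, hxu', h.adj]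
      have hc : ({u, u', y} : Finset V).card = 3 :=
        Finset.card_eq_three.2 ⟨_, _, _, huu.symm, huy, hu'y, rfl⟩
      have heq := Finset.eq_of_subset_of_card_le hsub (by have := hG.deg x; omega)
      intro w hw
      rw [← mem_nb, ← heq] at hw
      simpa using hw
    have h2 : (A \ {x, u, u'}).card = 2 := by
      have hs : ({x, u, u'} : Finset V) ⊆ A := by
        simp [Finset.insert_subset_iff, h.hx, hu, hu']
      rw [Finset.card_sdiff_of_subset hs, h.card,
        Finset.card_eq_three.2 ⟨_, _, _, hxu.ne, hxu'.ne, huu.symm, rfl⟩]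
    obtain ⟨p, q, hpq, hpqA⟩ := Finset.card_eq_two.1 h2
    have hmem : ∀ w, (w = p ∨ w = q) ↔ w ∈ A ∧ w ≠ x ∧ w ≠ u ∧ w ≠ u' := by
      intro w
      have := Finset.ext_iff.1 hpqA w
      simp only [Finset.mem_sdiff, Finset.mem_insert, Finset.mem_singleton, not_or] at this
      exact this.symm
    have hp := (hmem p).1 (Or.inl rfl)
    have hq := (hmem q).1 (Or.inr rfl)
    have hnb : ∀ v, (v = p ∨ v = q) → ∀ w, G.Adj v w → w = p ∨ w = q ∨ w = u ∨ w = u' := by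
      intro v hv w hw
      have hv' := (hmem v).1 hv
      have hwA := h.mem hv'.1 hw hv'.2.1
      have hwx : w ≠ x := by
        rintro rfl
        rcases hx3 v hw.symm with h' | h' | h'
        · exact hv'.2.2.1 h'
        · exact hv'.2.2.2 h'
        · exact h.hy (h' ▸ hv'.1)
      have := hmem w
      tauto
    by_cases hadj : G.Adj p q
    · obtain ⟨z, hzq, hpz⟩ := exists_adj_ne hG (h.sub hp.1) q
      have hz := hnb p (Or.inl rfl) z hpz
      have hzp := hpz.ne'
      rcases hz with hz | hz | hz | hz
      · exact absurd hz hzp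
      · exact absurd hz hzq
      · subst hz
        exact ⟨u', hu', hxu', packs_one hadj.symm hpz hzq.symm (by simp; tauto) (by simp; tauto)
          (by simp [hu, hxu.ne', huu.symm])⟩
      · subst hz
        exact ⟨u, hu, hxu, packs_one hadj.symm hpz hzq.symm (by simp; tauto) (by simp; tauto)
          (by simp [hu', hxu'.ne', huu])⟩
    · have key : ∀ v, (v = p ∨ v = q) → G.Adj v u := by
        intro v hv
        have hv' := (hmem v).1 hv
        obtain ⟨z, hzu, hz⟩ := exists_adj_ne hG (h.sub hv'.1) u'
        have hz' := hnb v hv z hz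
        have hzv := hz.ne'
        rcases hv with rfl | rfl
        · rcases hz' with rfl | rfl | rfl | rfl <;> tauto
        · have := hz.symm
          rcases hz' with rfl | rfl | rfl | rfl <;> tauto
      exact ⟨u', hu', hxu', packs_one (key p (Or.inl rfl)) (key q (Or.inr rfl)).symm hpq
        (by simp; tauto) (by simp [hu, hxu.ne', huu.symm]) (by simp; tauto)⟩
  · push Not at hu'
    refine ⟨u, hu, hxu, packs_one_of_card_three (hcard u hu hxu.ne') fun v hv => ?_⟩
    simp only [Finset.mem_sdiff, Finset.mem_insert, Finset.mem_singleton, not_or] at hv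
    obtain ⟨w, hwu, hvw⟩ := exists_adj_ne hG (h.sub hv.1) u
    refine ⟨w, ?_, hvw⟩
    have hwx : w ≠ x := by
      rintro rfl
      exact hu' v hv.1 hv.2.2 hvw.symm
    simp [h.mem hv.1 hvw hv.2.1, hwu, hwx]

theorem Pend.packs_erase {G : SimpleGraph V} (hG : Good G) {A : Finset V} {x y : V}
    (h : Pend G A x y) : Packs G (A \ {x}) 1 := by
  obtain ⟨u, -, -, hP⟩ := h.packs hG
  exact hP.subset (Finset.sdiff_subset_sdiff subset_rfl (by simp))

theorem Pend.packs_insert {G : SimpleGraph V} (hG : Good G) {A : Finset V} {x y : V}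
    (h : Pend G A x y) : Packs G (insert y A) 2 := by
  obtain ⟨u, hu, hxu, hP⟩ := h.packs hG
  have huy : u ≠ y := by rintro rfl; exact h.hy hu
  refine hP.add (packs_one (R := {u, x, y}) hxu.symm h.adj huy (by simp) (by simp) (by simp)) ?_ ?_
  · rw [Finset.disjoint_left]
    have := h.hy
    intro z; simp; grind
  · have := h.hx
    intro z; simp; grind

set_option maxHeartbeats 2000000 in
theorem Critical.pend_of_path {G : SimpleGraph V} (hG : Critical G) {s₁ s₂ s₃ : V}
    (h12 : G.Adj s₁ s₂) (h23 : G.Adj s₂ s₃) (h13 : s₁ ≠ s₃) (c1 : (nb G s₁).card = 2)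
    (c2 : (nb G s₂).card = 2) (c3 : (nb G s₃).card = 2) : ∃ A x y, Pend G A x y ∧ s₂ ∈ A := by
  obtain ⟨x, hxs, hsx, hs1⟩ := exists_of_nb_card_two c1 h12
  obtain ⟨y, hys, hsy, hs3⟩ := exists_of_nb_card_two c3 h23.symm
  have hs2 : ∀ w, G.Adj s₂ w → w = s₁ ∨ w = s₃ := by
    obtain ⟨b, hb, hsb, hs⟩ := exists_of_nb_card_two c2 h12.symm
    rcases hs _ h23 with h | h
    · exact absurd h.symm h13
    · rwa [h]
  have hP : Packs G {s₁, s₂, s₃} 1 := packs_one h12 h23 h13 (by simp) (by simp) (by simp)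
  have p1 := mem_posVerts_of_adj h12
  have p2 := mem_posVerts_of_adj h23
  have p3 := mem_posVerts_of_adj h23.symm
  have px := mem_posVerts_of_adj hsx.symm
  have py := mem_posVerts_of_adj hsy.symm
  have n12 := h12.ne
  have n23 := h23.ne
  have hx1 := hsx.ne'
  have hy3 := hsy.ne'
  by_cases hx3 : x = s₃
  · subst hx3
    refine (hG.closed (R := {s₁, s₂, x}) ⟨s₁, by simp⟩ ?_ ?_ hP
      (Finset.card_le_three.trans (by norm_num))).elim
    · simp [Finset.insert_subset_iff, p1, p2, p3]
    · have := hs3 _ hsx.symm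
      have hy1 : y = s₁ := by tauto
      subst hy1
      intro u hu w hw
      simp only [Finset.mem_insert, Finset.mem_singleton] at hu ⊢
      rcases hu with rfl | rfl | rfl
      · have := hs1 w hw; grind only
      · have := hs2 w hw; grind only
      · have := hs3 w hw; grind only
  have hy1 : y ≠ s₁ := by
    rintro rfl
    rcases hs1 _ hsy.symm with h | h
    · exact n23 h.symm
    · exact hx3 h.symm
  by_cases hxy : x = y
  · subst hxy
    have hC4 : ({x, s₁, s₂, s₃} : Finset V).card ≤ 4 := Finset.card_le_four
    have hPC : Packs G {x, s₁, s₂, s₃} 1 := hP.subset (by simp)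
    have hCp : ({x, s₁, s₂, s₃} : Finset V) ⊆ posVerts G := by
      simp [Finset.insert_subset_iff, p1, p2, p3, px]
    rcases hG.good.deg x with hx | hx | hx
    · exact absurd hx (mem_posVerts.1 px)
    · obtain ⟨b, hb, hxb, hxn⟩ := exists_of_nb_card_two hx hsx.symm
      have hb3 : s₃ = b := (hxn _ hsy.symm).resolve_left (Ne.symm h13)
      subst hb3
      refine (hG.closed (R := {x, s₁, s₂, s₃}) ⟨x, by simp⟩ hCp ?_ hPC (by omega)).elim
      intro u hu w hw
      simp only [Finset.mem_insert, Finset.mem_singleton] at hu ⊢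
      rcases hu with rfl | rfl | rfl | rfl
      · have := hxn w hw; grind only
      · have := hs1 w hw; grind only
      · have := hs2 w hw; grind only
      · have := hs3 w hw; grind only
    · obtain ⟨t, hxt, ht1, ht3, hxn⟩ : ∃ t, G.Adj x t ∧ t ≠ s₁ ∧ t ≠ s₃ ∧
          ∀ w, G.Adj x w → w = s₁ ∨ w = s₃ ∨ w = t := by
        obtain ⟨b, c, hb, hc, hbc, hxb, hxc, hxn⟩ := exists_of_nb_card_three hx hsx.symm
        rcases hxn _ hsy.symm with h | h | h
        · exact absurd h.symm h13
        · subst h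
          exact ⟨c, hxc, hc, hbc.symm, hxn⟩
        · subst h
          exact ⟨b, hxb, hb, hbc, fun w hw => by have := hxn w hw; grind only⟩
      have ht2 : t ≠ s₂ := by
        rintro rfl
        have := hs2 _ hxt.symm
        tauto
      have htx := hxt.ne'
      have pt := mem_posVerts_of_adj hxt.symm
      rcases hG.good.deg t with ht | ht | ht
      · exact absurd ht (mem_posVerts.1 pt)
      · obtain ⟨t', ht', htt, htn⟩ := exists_of_nb_card_two ht hxt.symm
        have m1 : t' ≠ s₁ := by
          rintro rfl
          have := hs1 _ htt.symm; tauto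
        have m2 : t' ≠ s₂ := by
          rintro rfl
          have := hs2 _ htt.symm; tauto
        have m3 : t' ≠ s₃ := by
          rintro rfl
          have := hs3 _ htt.symm; tauto
        have m4 := htt.ne'
        refine ⟨{x, s₁, s₂, s₃, t}, t, t', ⟨?_, ?_, by simp, ?_, htt, ?_⟩, by simp⟩
        · repeat rw [Finset.card_insert_of_notMem (by simp; tauto)]
          simp
        · simp [Finset.insert_subset_iff, p1, p2, p3, px, pt]
        · simp; tauto
        · intro u hu w hw huw
          simp only [Finset.mem_insert, Finset.mem_singleton] at hu hw
          rcases hu with rfl | rfl | rfl | rfl | rfl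
          · have := hxn w huw; grind only
          · have := hs1 w huw; grind only
          · have := hs2 w huw; grind only
          · have := hs3 w huw; grind only
          · have := htn w huw; grind only
      · obtain ⟨A, hA | hA⟩ := hG.pend_of_adj hxt hx ht
        · have a1 := hA.mem_of_ne hA.hx hsx.symm ht1.symm
          exact ⟨A, _, _, hA, hA.mem a1 h12 hx1.symm⟩
        · have b1 : s₁ ∉ A := fun h => ht1 (hA.out _ h _ hA.hy hsx).1.symm
          have b3 : s₃ ∉ A := fun h => ht3 (hA.out _ h _ hA.hy hsy).1.symm
          have b2 : s₂ ∉ A := fun h => ht2 (hA.out _ h _ b1 h12.symm).1.symm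
          have hd : Disjoint (insert x A) {s₁, s₂, s₃} := by
            rw [Finset.disjoint_left]
            intro z hz hz'
            simp only [Finset.mem_insert, Finset.mem_singleton] at hz hz'
            rcases hz with rfl | hz
            · tauto
            · rcases hz' with rfl | rfl | rfl <;> tauto
          refine (hG.closed (R := insert x A ∪ {s₁, s₂, s₃}) ⟨x, by simp⟩ ?_ ?_
            ((hA.packs_insert hG.good).union hP hd) ?_).elim
          · have := hA.sub
            intro z
            simp only [Finset.mem_union, Finset.mem_insert, Finset.mem_singleton]
            rintro ((rfl | h) | (rfl | rfl | rfl)) <;> tauto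
          · have := hA.hx
            intro u hu w hw
            simp only [Finset.mem_union, Finset.mem_insert, Finset.mem_singleton] at hu ⊢
            rcases hu with (rfl | h) | (rfl | rfl | rfl)
            · rcases hxn w hw with rfl | rfl | rfl <;> tauto
            · by_contra! hc
              exact hc.1.1 (hA.out _ h _ hc.1.2 hw).2
            · have := hs1 w hw; grind only
            · have := hs2 w hw; grind only
            · have := hs3 w hw; grind only
          · have := Finset.card_union_le (insert x A) {s₁, s₂, s₃}
            have := Finset.card_insert_le x A
            have := hA.card
            have : ({s₁, s₂, s₃} : Finset V).card ≤ 3 := Finset.card_le_three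
            omega
  by_cases hadj : G.Adj x y
  · have hA5 : ({x, s₁, s₂, s₃, y} : Finset V).card = 5 := by
      repeat rw [Finset.card_insert_of_notMem (by simp; tauto)]
      simp
    have hAp : ({x, s₁, s₂, s₃, y} : Finset V) ⊆ posVerts G := by
      simp [Finset.insert_subset_iff, p1, p2, p3, px, py]
    have third : ∀ p s, G.Adj p s → (nb G p).card = 3 → ∀ q, G.Adj p q → q ≠ s →
        ∃ t, G.Adj p t ∧ t ≠ s ∧ t ≠ q ∧ ∀ w, G.Adj p w → w = s ∨ w = q ∨ w = t := by
      intro p s hps hp q hpq hqs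
      obtain ⟨b, c, hb, hc, hbc, hxb, hxc, hxn⟩ := exists_of_nb_card_three hp hps
      rcases hxn _ hpq with h | h | h
      · exact absurd h hqs
      · subst h
        exact ⟨c, hxc, hc, hbc.symm, hxn⟩
      · subst h
        exact ⟨b, hxb, hb, hbc, fun w hw => by have := hxn w hw; grind only⟩
    have second : ∀ p s, G.Adj p s → (nb G p).card = 2 → ∀ q, G.Adj p q → q ≠ s →
        ∀ w, G.Adj p w → w = s ∨ w = q := by
      intro p s hps hp q hpq hqs
      obtain ⟨b, hb, hxb, hxn⟩ := exists_of_nb_card_two hp hps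
      rcases hxn _ hpq with h | h
      · exact absurd h hqs
      · rwa [h]
    rcases hG.good.deg x with hx | hx | hx
    · exact absurd hx (mem_posVerts.1 px)
    · have hxn := second _ _ hsx.symm hx _ hadj hy1
      rcases hG.good.deg y with hy | hy | hy
      · exact absurd hy (mem_posVerts.1 py)
      · have hyn := second _ _ hsy.symm hy _ hadj.symm hx3
        obtain ⟨u, hu, w, hw, huw⟩ := hG.good.five _ hA5 hAp
        simp only [Finset.mem_insert, Finset.mem_singleton] at hu hw
        rcases hu with rfl | rfl | rfl | rfl | rfl
        · have := hxn w huw; grind only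
        · have := hs1 w huw; grind only
        · have := hs2 w huw; grind only
        · have := hs3 w huw; grind only
        · have := hyn w huw; grind only
      · obtain ⟨t, hyt, ht1, ht2, hyn⟩ := third _ _ hsy.symm hy _ hadj.symm hx3
        have htA : t ∉ ({x, s₁, s₂, s₃, y} : Finset V) := by
          have := hyt.ne'
          have : t ≠ s₁ := by rintro rfl; have := hs1 _ hyt.symm; tauto
          have : t ≠ s₂ := by rintro rfl; have := hs2 _ hyt.symm; tauto
          simp; tauto
        refine ⟨_, y, t, ⟨hA5, hAp, by simp, htA, hyt, ?_⟩, by simp⟩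
        intro u hu w hw huw
        simp only [Finset.mem_insert, Finset.mem_singleton] at hu hw
        rcases hu with rfl | rfl | rfl | rfl | rfl
        · have := hxn w huw; grind only
        · have := hs1 w huw; grind only
        · have := hs2 w huw; grind only
        · have := hs3 w huw; grind only
        · have := hyn w huw; grind only
    · rcases hG.good.deg y with hy | hy | hy
      · exact absurd hy (mem_posVerts.1 py)
      · have hyn := second _ _ hsy.symm hy _ hadj.symm hx3
        obtain ⟨t, hxt, ht1, ht2, hxn⟩ := third _ _ hsx.symm hx _ hadj hy1
        have htA : t ∉ ({x, s₁, s₂, s₃, y} : Finset V) := by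
          have := hxt.ne'
          have : t ≠ s₃ := by rintro rfl; have := hs3 _ hxt.symm; tauto
          have : t ≠ s₂ := by rintro rfl; have := hs2 _ hxt.symm; tauto
          simp; tauto
        refine ⟨_, x, t, ⟨hA5, hAp, by simp, htA, hxt, ?_⟩, by simp⟩
        intro u hu w hw huw
        simp only [Finset.mem_insert, Finset.mem_singleton] at hu hw
        rcases hu with rfl | rfl | rfl | rfl | rfl
        · have := hxn w huw; grind only
        · have := hs1 w huw; grind only
        · have := hs2 w huw; grind only
        · have := hs3 w huw; grind only
        · have := hyn w huw; grind only
      · obtain ⟨A, hA | hA⟩ := hG.pend_of_adj hadj hx hy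
        · have a1 := hA.mem_of_ne hA.hx hsx.symm hy1.symm
          exact ⟨A, _, _, hA, hA.mem a1 h12 hx1.symm⟩
        · have a3 := hA.mem_of_ne hA.hx hsy.symm (Ne.symm hx3)
          exact ⟨A, _, _, hA, hA.mem a3 h23.symm hy3.symm⟩
  · refine (hG.no_bypass h12 h23 h13 hsx.symm hsy.symm (by simp; tauto) (by simp; tauto) hxy hadj
      (fun w hw => (hs1 w hw).symm) hs2 fun w hw => (hs3 w hw).symm).elim

theorem Critical.pend_card_three {G : SimpleGraph V} (hG : Critical G) {A : Finset V} {x y : V}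
    (h : Pend G A x y) : (nb G y).card = 3 := by
  have hP := h.packs_insert hG.good
  have hR6 : (insert y A).card = 6 := by rw [Finset.card_insert_of_notMem h.hy, h.card]
  have py := mem_posVerts_of_adj h.adj.symm
  rcases hG.good.deg y with hy | hy | hy
  · exact absurd hy (mem_posVerts.1 py)
  · exfalso
    obtain ⟨z, hzx, hyz, hyn⟩ := exists_of_nb_card_two hy h.adj.symm
    have hzA : z ∉ A := fun hz => hzx (h.out z hz y h.hy hyz.symm).1
    have hzy := hyz.ne'
    have hRp : insert y A ⊆ posVerts G := Finset.insert_subset py h.sub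
    have hzR : z ∉ insert y A := by simp [hzA, hzy]
    have hRout : ∀ u ∈ insert y A, ∀ w, w ∉ insert y A → G.Adj u w → u = y ∧ w = z := by
      intro u hu w hw huw
      rw [Finset.mem_insert, not_or] at hw
      rw [Finset.mem_insert] at hu
      rcases hu with rfl | hu
      · rcases hyn w huw with rfl | rfl
        · exact absurd h.hx hw.2
        · exact ⟨rfl, rfl⟩
      · exact absurd (h.out u hu w hw.2 huw).2 hw.1
    have pz := mem_posVerts_of_adj hyz.symm
    rcases hG.good.deg z with hz | hz | hz
    · exact absurd hz (mem_posVerts.1 pz)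
    · obtain ⟨w, hwy, hzw, hzn⟩ := exists_of_nb_card_two hz hyz.symm
      have hwA : w ∉ A := fun hw => hzy (h.out w hw z hzA hzw.symm).2
      have hwz := hzw.ne'
      have pw := mem_posVerts_of_adj hzw.symm
      rcases hG.good.deg w with hw | hw | hw
      · exact absurd hw (mem_posVerts.1 pw)
      · obtain ⟨w', hwz', hww, hwn⟩ := exists_of_nb_card_two hw hzw.symm
        have hxz : x ≠ z := fun e => hzA (e ▸ h.hx)
        have hxw : x ≠ w := fun e => hwA (e ▸ h.hx)
        have hwy' : w' ≠ y := by
          rintro rfl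
          rcases hyn _ hww.symm with e | e
          · exact hxw e.symm
          · exact hwz e
        have hw' : w' ∉ A := fun hw' => hwy (h.out w' hw' w hwA hww.symm).2
        refine hG.no_bypass hyz hzw hwy.symm h.adj hww.symm
          (by simp [h.adj.ne, hxz, hxw]) (by simp [hwy', hwz', hww.ne']) (fun e => hw' (e ▸ h.hx))
          (fun hadj => hwy' (h.out x h.hx w' hw' hadj).2) hyn hzn fun v hv => (hwn v hv).symm
      · have hwR : w ∉ insert z (insert y A) := by simp [hwA, hwy, hwz]
        refine hG.one_out (R := insert z (insert y A)) (r := z) (z := w) (by simp) hwR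
          (Finset.insert_subset pz hRp) hzw ?_ hw (hP.subset (by simp)) (by
            rw [Finset.card_insert_of_notMem hzR, hR6])
        intro u hu v hv huv
        rw [Finset.mem_insert, not_or] at hv
        rw [Finset.mem_insert] at hu
        rcases hu with rfl | hu
        · rcases hzn v huv with rfl | rfl
          · exact absurd (by simp) hv.2
          · exact ⟨rfl, rfl⟩
        · exact absurd (hRout u hu v hv.2 huv).2 hv.1
    · exact hG.one_out (by simp) hzR hRp hyz hRout hz hP (by omega)
  · exact hy

theorem Critical.pend_notMem {G : SimpleGraph V} (hG : Critical G) {A A' : Finset V}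
    {x y x' y' : V} (h : Pend G A x y) (h' : Pend G A' x' y') : y ∉ A' := by
  intro hyA'
  have hsplit : (A \ A').card + (A ∩ A').card = 5 := by
    rw [Finset.card_sdiff_add_card_inter, h.card]
  have hsplit' : (A' \ A).card + (A ∩ A').card = 5 := by
    rw [Finset.inter_comm, Finset.card_sdiff_add_card_inter, h'.card]
  have hunion : (A ∪ A').card = 5 + (A' \ A).card := by
    have := Finset.card_union_add_card_inter A A'
    have := h.card
    have := h'.card
    omega
  have hsub : A ∪ A' ⊆ posVerts G := Finset.union_subset h.sub h'.sub
  have hIsub : A ∩ A' ⊆ posVerts G := Finset.inter_subset_left.trans h.sub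
  have hJsub : A \ A' ⊆ posVerts G := Finset.sdiff_subset.trans h.sub
  have hJsub' : A' \ A ⊆ posVerts G := Finset.sdiff_subset.trans h'.sub
  by_cases hx : x ∈ A'
  · have hIne : (A ∩ A').Nonempty := ⟨x, by simp [h.hx, hx]⟩
    have hJout : ∀ u ∈ A \ A', ∀ w, w ∉ A \ A' → G.Adj u w → u = y' ∧ w = x' := by
      intro u hu w hw huw
      rw [Finset.mem_sdiff] at hu hw
      have hwA : w ∈ A := h.mem hu.1 huw (by rintro rfl; exact hu.2 hx)
      have hwA' : w ∈ A' := by tauto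
      exact (h'.out w hwA' u hu.2 huw.symm).symm
    have hJne : (A \ A').Nonempty := by
      rw [Finset.sdiff_nonempty]
      intro hs
      have := Finset.eq_of_subset_of_card_le hs (by rw [h.card, h'.card])
      exact h.hy (this ▸ hyA')
    have hJ3 := three_le_card hG.good hJsub hJne _ _ hJout
    have hIout : x' ∉ A ∩ A' ∨ y' ∉ A → ∀ u ∈ A ∩ A', ∀ w, w ∉ A ∩ A' → G.Adj u w →
        u = x ∧ w = y := by
      intro hor u hu w hw huw
      by_cases hwA : w ∈ A
      · have hwA' : w ∉ A' := fun h => hw (Finset.mem_inter.2 ⟨hwA, h⟩)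
        obtain ⟨rfl, rfl⟩ := h'.out u (Finset.mem_inter.1 hu).2 w hwA' huw
        tauto
      · exact h.out u (Finset.mem_inter.1 hu).1 w hwA huw
    have hxy' : x' ∈ A ∩ A' ∧ y' ∈ A := by
      by_contra hcon
      have := three_le_card hG.good hIsub hIne _ _ (hIout (by tauto))
      omega
    obtain ⟨hx', hy'⟩ := hxy'
    have hyJ' : y' ∈ A \ A' := by simp [hy', h'.hy]
    have hyJ : y ∈ A' \ A := by simp [hyA', h.hy]
    have hJout' : ∀ u ∈ A' \ A, ∀ w, w ∉ A' \ A → G.Adj u w → u = y ∧ w = x := by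
      intro u hu w hw huw
      rw [Finset.mem_sdiff] at hu hw
      have hwA' : w ∈ A' := h'.mem hu.1 huw (by
        rintro rfl; exact hu.2 (Finset.mem_inter.1 hx').1)
      have hwA : w ∈ A := by tauto
      exact (h.out w hwA u hu.2 huw.symm).symm
    have hcl : ∀ u ∈ A ∪ A', ∀ w, G.Adj u w → w ∈ A ∪ A' := by
      intro u hu w huw
      rw [Finset.mem_union] at hu ⊢
      by_contra! hw
      rcases hu with hu | hu
      · exact hw.2 ((h.out u hu w hw.1 huw).2 ▸ hyA')
      · exact hw.1 ((h'.out u hu w hw.2 huw).2 ▸ hy')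
    have hdis : Disjoint (A \ A') (A' \ A) := by
      rw [Finset.disjoint_left]
      intro z; simp; tauto
    have hne : (A ∪ A').Nonempty := ⟨x, by simp [h.hx]⟩
    have hIpos := Finset.card_pos.2 hIne
    by_cases h3 : (A \ A').card = 3
    · have hp : ∀ X : Finset V, X ⊆ posVerts G → X.card = 3 → ∀ p q,
          (∀ u ∈ X, ∀ w, w ∉ X → G.Adj u w → u = p ∧ w = q) → Packs G X 1 := by
        intro X hX hX3 p q hout
        obtain ⟨v, hv, hvp⟩ := Finset.exists_mem_ne (by omega : 1 < X.card) p
        refine packs_of_pos hG.good hv (hX hv) fun w hw => ?_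
        by_contra hwX
        exact hvp (hout v hv w hwX hw).1
      refine hG.closed hne hsub hcl ((hp _ hJsub h3 _ _ hJout).add
        (hp _ hJsub' (by omega) _ _ hJout') hdis ?_) (by omega)
      intro z; simp; tauto
    · have h4 : (A \ A').card = 4 := by omega
      have hI1 : (A ∩ A').card = 1 := by omega
      have hp : ∀ X : Finset V, X ⊆ posVerts G → X.card = 4 → ∀ p q, p ∈ X →
          (∀ u ∈ X, ∀ w, w ∉ X → G.Adj u w → u = p ∧ w = q) → Packs G (X \ {p}) 1 := by
        intro X hX hX4 p q hpX hout
        refine packs_one_of_card_three (by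
          rw [Finset.card_sdiff_of_subset (by simpa using hpX), hX4, Finset.card_singleton]) ?_
        intro v hv
        rw [Finset.mem_sdiff, Finset.mem_singleton] at hv
        obtain ⟨w, hwp, hw⟩ := exists_adj_ne hG.good (hX hv.1) p
        refine ⟨w, ?_, hw⟩
        rw [Finset.mem_sdiff, Finset.mem_singleton]
        refine ⟨?_, hwp⟩
        by_contra hwX
        exact hv.2 (hout v hv.1 w hwX hw).1
      have hxx : x' = x := by
        obtain ⟨a, ha⟩ := Finset.card_eq_one.1 hI1
        have h1 : x ∈ A ∩ A' := by simp [h.hx, hx]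
        rw [ha, Finset.mem_singleton] at h1 hx'
        rw [h1, hx']
      subst hxx
      have hyy : y' ≠ y := by rintro rfl; exact h.hy hy'
      have k2 := (hp _ hJsub h4 _ _ hyJ' hJout).union (hp _ hJsub' (by omega) _ _ hyJ hJout')
        (hdis.mono Finset.sdiff_subset Finset.sdiff_subset)
      refine hG.closed hne hsub hcl ((packs_one (R := {y', x', y}) h'.adj.symm h.adj hyy
        (by simp) (by simp) (by simp)).add k2 ?_ ?_) (by omega)
      · have := h.hx
        rw [Finset.disjoint_left]
        intro z; simp; grind
      · have := h.hx
        intro z; simp; grind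
  · obtain ⟨rfl, rfl⟩ := h'.out y hyA' x hx h.adj.symm
    have hJ3 := three_le_card hG.good hJsub ⟨x, by simp [h.hx, hx]⟩ x y (by
      intro u hu w hw huw
      rw [Finset.mem_sdiff] at hu hw
      refine h.out u hu.1 w (fun hwA => ?_) huw
      have hwA' : w ∈ A' := by tauto
      have := h'.out w hwA' u hu.2 huw.symm
      exact h.hy (this.1 ▸ hwA))
    have hd : Disjoint A A' := by
      rw [Finset.disjoint_iff_inter_eq_empty]
      by_contra hne
      have := three_le_card hG.good hIsub (Finset.nonempty_iff_ne_empty.2 hne) x y (by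
        intro u hu w hw huw
        rw [Finset.mem_inter] at hu hw
        refine h.out u hu.1 w (fun hwA => ?_) huw
        have := h'.out u hu.2 w (by tauto) huw
        exact h.hy (this.1 ▸ hu.1))
      omega
    refine hG.closed (R := A ∪ A') ⟨x, by simp [h.hx]⟩ hsub ?_
      (((h.packs_insert hG.good).add (h'.packs_erase hG.good) ?_ ?_)) (k := 3) (by omega)
    · intro u hu w huw
      rw [Finset.mem_union] at hu ⊢
      by_contra! hw
      rcases hu with hu | hu
      · exact hw.2 ((h.out u hu w hw.1 huw).2 ▸ hyA')
      · exact hw.1 ((h'.out u hu w hw.2 huw).2 ▸ h.hx)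
    · rw [Finset.disjoint_left] at hd ⊢
      intro z; simp; grind
    · intro z; simp; grind

theorem Critical.pend_disjoint {G : SimpleGraph V} (hG : Critical G) {A A' : Finset V}
    {x y x' y' : V} (h : Pend G A x y) (h' : Pend G A' x' y') (hne : A ≠ A') :
    Disjoint A A' := by
  have hyA := hG.pend_notMem h' h
  have hsplit : (A \ A').card + (A ∩ A').card = 5 := by
    rw [Finset.card_sdiff_add_card_inter, h.card]
  have hJne : (A \ A').Nonempty := by
    rw [Finset.sdiff_nonempty]
    exact fun hs => hne (Finset.eq_of_subset_of_card_le hs (by rw [h.card, h'.card]))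
  have hJ := three_le_card hG.good (Finset.sdiff_subset.trans h.sub) hJne x y (by
    intro u hu w hw huw
    rw [Finset.mem_sdiff] at hu hw
    refine h.out u hu.1 w (fun hwA => ?_) huw
    exact hyA ((h'.out w (by tauto) u hu.2 huw.symm).2 ▸ hu.1))
  rw [Finset.disjoint_iff_inter_eq_empty]
  by_contra hI
  have := three_le_card hG.good (Finset.inter_subset_left.trans h.sub)
    (Finset.nonempty_iff_ne_empty.2 hI) x y (by
      intro u hu w hw huw
      rw [Finset.mem_inter] at hu hw
      refine h.out u hu.1 w (fun hwA => ?_) huw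
      exact hyA ((h'.out u hu.2 w (by tauto) huw).2 ▸ hwA))
  omega

theorem Critical.elim {G : SimpleGraph V} (hG : Critical G) : False := by
  classical
  set 𝒜 : Finset (Finset V) := Finset.univ.filter (fun A => ∃ x y, Pend G A x y) with h𝒜
  obtain ⟨v₀, -⟩ := Finset.card_pos.1 (Nat.zero_lt_of_lt (hG.none 0 (Packs.zero _ _)))
  have hex : ∀ A : Finset V, ∃ p : V × V, (∃ x y, Pend G A x y) → Pend G A p.1 p.2 := by
    intro A
    by_cases h : ∃ x y, Pend G A x y
    · obtain ⟨x, y, h⟩ := h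
      exact ⟨(x, y), fun _ => h⟩
    · exact ⟨(v₀, v₀), fun h' => absurd h' h⟩
  choose rt hrt using hex
  have hP : ∀ A ∈ 𝒜, Pend G A (rt A).1 (rt A).2 := fun A hA =>
    hrt A (by simpa [h𝒜] using hA)
  have hmem : ∀ A x y, Pend G A x y → A ∈ 𝒜 := fun A x y h => by
    simp only [h𝒜, Finset.mem_filter, Finset.mem_univ, true_and]
    exact ⟨x, y, h⟩
  have hdisj : ∀ A ∈ 𝒜, ∀ A' ∈ 𝒜, ∀ v, v ∈ A → v ∈ A' → A = A' := by
    intro A hA A' hA' v hv hv'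
    by_contra hne
    exact Finset.disjoint_left.1 (hG.pend_disjoint (hP A hA) (hP A' hA') hne) hv hv'
  set U : Finset V := 𝒜.biUnion id with hU
  have hmU : ∀ v, v ∈ U ↔ ∃ A ∈ 𝒜, v ∈ A := fun v => by simp [hU]
  set B : Finset V := Finset.univ.filter (fun v => (nb G v).card = 3 ∧ v ∉ U) with hB
  set S : Finset V := Finset.univ.filter (fun v => (nb G v).card = 2 ∧ v ∉ U) ∪
    𝒜.image (fun A => (rt A).1) with hS
  have hmB : ∀ v, v ∈ B ↔ (nb G v).card = 3 ∧ v ∉ U := fun v => by simp [hB]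
  have hmS : ∀ v, v ∈ S ↔ ((nb G v).card = 2 ∧ v ∉ U) ∨ ∃ A ∈ 𝒜, (rt A).1 = v :=
    fun v => by simp [hS]
  have hroot : ∀ v ∈ U, ∀ w, w ∉ U → G.Adj v w → ∃ A ∈ 𝒜, v = (rt A).1 ∧ w = (rt A).2 := by
    intro v hv w hw hvw
    obtain ⟨A, hA, hvA⟩ := (hmU v).1 hv
    exact ⟨A, hA, (hP A hA).out v hvA w (fun h => hw ((hmU w).2 ⟨A, hA, h⟩)) hvw⟩
  have htB : ∀ A ∈ 𝒜, (rt A).2 ∈ B := by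
    intro A hA
    rw [hmB]
    refine ⟨hG.pend_card_three (hP A hA), fun h => ?_⟩
    obtain ⟨A', hA', h⟩ := (hmU _).1 h
    exact hG.pend_notMem (hP A hA) (hP A' hA') h
  have hrU : ∀ A ∈ 𝒜, (rt A).1 ∈ U := fun A hA => (hmU _).2 ⟨A, hA, (hP A hA).hx⟩
  have hrS : ∀ A ∈ 𝒜, (rt A).1 ∈ S := fun A hA => (hmS _).2 (Or.inr ⟨A, hA, rfl⟩)
  have hBS : ∀ b ∈ B, ∀ s, G.Adj b s → s ∈ S := by
    intro b hb s hbs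
    rw [hmB] at hb
    rw [hmS]
    by_cases hs : s ∈ U
    · obtain ⟨A, hA, h1, -⟩ := hroot s hs b hb.2 hbs.symm
      exact Or.inr ⟨A, hA, h1.symm⟩
    · rcases hG.good.deg s with h | h | h
      · exact absurd h (mem_posVerts.1 (mem_posVerts_of_adj hbs.symm))
      · exact Or.inl ⟨h, hs⟩
      · obtain ⟨A, hA | hA⟩ := hG.pend_of_adj hbs hb.1 h
        · exact absurd ((hmU _).2 ⟨A, hmem _ _ _ hA, hA.hx⟩) hb.2
        · exact absurd ((hmU _).2 ⟨A, hmem _ _ _ hA, hA.hx⟩) hs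
  have hfil : ∀ b ∈ B, S.filter (fun s => b ∈ B ∩ nb G s) = nb G b := by
    intro b hb
    ext s
    rw [Finset.mem_filter, Finset.mem_inter, mem_nb, mem_nb]
    exact ⟨fun h => h.2.2.symm, fun h => ⟨hBS b hb s h, hb, h.symm⟩⟩
  obtain ⟨Y, hYB, f, g, hfg, hfgd, hcard⟩ := two_leaf_star_packing S (fun s => B ∩ nb G s) B
    (fun _ _ => Finset.inter_subset_left) (fun b hb => by rw [hfil b hb]; exact ((hmB b).1 hb).1)
    (by
      intro s hs
      rcases (hmS s).1 hs with ⟨hs2, hsU⟩ | ⟨A, hA, rfl⟩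
      · have hle : (B ∩ nb G s).card ≤ (nb G s).card :=
          Finset.card_le_card Finset.inter_subset_right
        have hne : (B ∩ nb G s).card ≠ 0 := by
          intro h0
          rw [Finset.card_eq_zero] at h0
          have hn2 : ∀ v, G.Adj s v → (nb G v).card = 2 := by
            intro v hv
            have hvU : v ∉ U := by
              intro hvU
              obtain ⟨A, hA, -, h2⟩ := hroot v hvU s hsU hv.symm
              have := hG.pend_card_three (hP A hA)
              rw [← h2] at this
              omega
            have hvB : v ∉ B := by
              intro hvB
              have : v ∈ B ∩ nb G s := by simp [hvB, hv]
              rw [h0] at this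
              simp at this
            have := hG.good.deg v
            have := mem_posVerts.1 (mem_posVerts_of_adj hv.symm)
            have := mt (hmB v).2 hvB
            tauto
          obtain ⟨a, b, hab, ha, hb⟩ := exists_adj_two hG.good
            (mem_posVerts.2 (by omega : (nb G s).card ≠ 0))
          obtain ⟨A, x, y, hA, hsA⟩ := hG.pend_of_path ha.symm hb hab (hn2 a ha) hs2 (hn2 b hb)
          exact hsU ((hmU s).2 ⟨A, hmem _ _ _ hA, hsA⟩)
        omega
      · left
        rw [Finset.card_eq_one]
        refine ⟨(rt A).2, ?_⟩
        ext b
        rw [Finset.mem_inter, mem_nb, Finset.mem_singleton]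
        constructor
        · rintro ⟨hb, hadj⟩
          exact ((hP A hA).out _ (hP A hA).hx b
            (fun h => ((hmB b).1 hb).2 ((hmU b).2 ⟨A, hA, h⟩)) hadj).2
        · rintro rfl
          exact ⟨htB A hA, (hP A hA).adj⟩)
    (by
      intro b hb b' hb' heq
      rw [hfil b hb, hfil b' hb'] at heq
      by_contra hne
      have hbU := ((hmB b).1 hb).2
      have hbU' := ((hmB b').1 hb').2
      have hadj' : ∀ s, G.Adj b s → G.Adj b' s := fun s hs => by
        rw [← mem_nb, ← heq, mem_nb]; exact hs
      have hs2 : ∀ s, G.Adj b s → ∀ w, G.Adj s w → w = b ∨ w = b' := by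
        intro s hs
        have hs' := hadj' s hs
        rcases (hmS s).1 (hBS b hb s hs) with ⟨h2, -⟩ | ⟨A, hA, rfl⟩
        · obtain ⟨c, hc, hsc, hsn⟩ := exists_of_nb_card_two h2 hs.symm
          rcases hsn _ hs'.symm with h | h
          · exact absurd h.symm hne
          · rwa [h]
        · have h1 := (hP A hA).out _ (hP A hA).hx b (fun h => hbU ((hmU b).2 ⟨A, hA, h⟩)) hs.symm
          have h2 := (hP A hA).out _ (hP A hA).hx b' (fun h => hbU' ((hmU b').2 ⟨A, hA, h⟩))
            hs'.symm
          exact absurd (h1.2.trans h2.2.symm) hne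
      have hb'n : b' ∉ nb G b := by rw [heq]; simp
      have hbn : b ∉ insert b' (nb G b) := by simp [hne]
      obtain ⟨u, hu, w, hw, huw⟩ := hG.good.five (insert b (insert b' (nb G b)))
        (by rw [Finset.card_insert_of_notMem hbn, Finset.card_insert_of_notMem hb'n,
              ((hmB b).1 hb).1]) (by
          intro v hv
          rw [Finset.mem_insert, Finset.mem_insert, mem_nb] at hv
          rcases hv with rfl | rfl | hv
          · rw [mem_posVerts, ((hmB v).1 hb).1]; simp
          · rw [mem_posVerts, ((hmB v).1 hb').1]; simp
          · exact mem_posVerts_of_adj hv.symm)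
      rw [Finset.mem_insert, Finset.mem_insert, mem_nb] at hu hw
      rcases hu with rfl | rfl | hu
      · tauto
      · rw [← mem_nb, ← heq, mem_nb] at huw
        tauto
      · have := hs2 u hu w huw
        tauto)
  have hBSd : ∀ v ∈ B, v ∉ S := by
    intro v hv hvS
    rw [hmB] at hv
    rcases (hmS v).1 hvS with h | ⟨A, hA, rfl⟩
    · omega
    · exact hv.2 (hrU A hA)
  have hadjK : ∀ y s, y ∈ B ∩ nb G s → G.Adj s y := fun y s h => by
    rw [Finset.mem_inter, mem_nb] at h; exact h.2
  have hpY : Packs G (Y.biUnion fun y => {f y, y, g y}) Y.card := by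
    refine Packs.biUnion Y _ (fun y hy => ?_) fun y hy y' hy' hne => ?_
    · obtain ⟨-, -, h3, h4, h5⟩ := hfg y hy
      exact packs_one (hadjK _ _ h4) (hadjK _ _ h5).symm h3 (by simp) (by simp) (by simp)
    · have hd := hfgd y hy y' hy' hne
      rw [Finset.disjoint_left] at hd ⊢
      have h1 := hfg y hy
      have h2 := hfg y' hy'
      have h3 := hBSd y (hYB hy)
      have h4 := hBSd y' (hYB hy')
      simp only [Finset.mem_insert, Finset.mem_singleton] at hd ⊢
      grind
  have hpA : Packs G (𝒜.biUnion fun A => A \ {(rt A).1}) 𝒜.card := by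
    refine Packs.biUnion 𝒜 _ (fun A hA => (hP A hA).packs_erase hG.good) fun A hA A' hA' hne => ?_
    exact (hG.pend_disjoint (hP A hA) (hP A' hA') hne).mono Finset.sdiff_subset Finset.sdiff_subset
  have hYA : Disjoint (Y.biUnion fun y => {f y, y, g y}) (𝒜.biUnion fun A => A \ {(rt A).1}) := by
    rw [Finset.disjoint_left]
    intro v hv hv'
    rw [Finset.mem_biUnion] at hv hv'
    obtain ⟨A, hA, hv'⟩ := hv'
    rw [Finset.mem_sdiff, Finset.mem_singleton] at hv'
    have hvU : v ∈ U := (hmU v).2 ⟨A, hA, hv'.1⟩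
    have hvS : v ∉ S := by
      intro hvS
      rcases (hmS v).1 hvS with h | ⟨A', hA', rfl⟩
      · exact h.2 hvU
      · obtain rfl := hdisj A hA A' hA' _ hv'.1 (hP A' hA').hx
        exact hv'.2 rfl
    obtain ⟨y, hy, hv⟩ := hv
    simp only [Finset.mem_insert, Finset.mem_singleton] at hv
    rcases hv with rfl | rfl | rfl
    · exact hvS (hfg y hy).1
    · exact ((hmB v).1 (hYB hy)).2 hvU
    · exact hvS (hfg y hy).2.1
  have hcov : posVerts G ⊆ (𝒜.biUnion fun A => A \ {(rt A).1}) ∪ (B ∪ S) := by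
    intro v hv
    rw [Finset.mem_union, Finset.mem_union, Finset.mem_biUnion]
    by_cases hvU : v ∈ U
    · obtain ⟨A, hA, hvA⟩ := (hmU v).1 hvU
      by_cases h : v = (rt A).1
      · exact Or.inr (Or.inr (h ▸ hrS A hA))
      · exact Or.inl ⟨A, hA, by simp [hvA, h]⟩
    · right
      rw [hmB, hmS]
      have := hG.good.deg v
      have := mem_posVerts.1 hv
      tauto
  have h1 := hG.none _ (hpY.add hpA hYA (Finset.subset_univ _))
  have h2 := Finset.card_le_card hcov
  have h3 := Finset.card_union_le (𝒜.biUnion fun A => A \ {(rt A).1}) (B ∪ S)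
  have h4 := Finset.card_union_le B S
  have h5 : (𝒜.biUnion fun A => A \ {(rt A).1}).card ≤ 𝒜.card * 4 :=
    Finset.card_biUnion_le_card_mul _ _ _ fun A hA => by
      rw [Finset.card_sdiff_of_subset (by simpa using (hP A hA).hx), (hP A hA).card,
        Finset.card_singleton]
  omega

theorem Good.exists_packs {G : SimpleGraph V} (hG : Good G) :
    ∃ k, Packs G Finset.univ k ∧ (posVerts G).card ≤ 4 * k := by
  induction hn : ∑ v, (nb G v).card using Nat.strong_induction_on generalizing G with
  | _ n ih =>
    by_contra! hcon
    exact Critical.elim ⟨hG, fun G' hG' hlt => ih _ (hn ▸ hlt) hG' rfl, hcon⟩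

theorem good_of_components {G : SimpleGraph V}
    (hdeg : ∀ v, (nb G v).card = 2 ∨ (nb G v).card = 3)
    (hcomp : ∀ c : G.ConnectedComponent, c.supp.ncard ≠ 5) : Good G := by
  classical
  refine ⟨fun v => Or.inr (hdeg v), fun A hA _ => ?_⟩
  by_contra! hcl
  have hcl' : ∀ u ∈ A, ∀ w, G.Adj u w → w ∈ A := fun u hu w huw => by
    by_contra hw
    exact hcl u hu w hw huw
  obtain ⟨v, hv⟩ := Finset.card_pos.1 (by omega : 0 < A.card)
  have three : ∀ T : Finset V, T.Nonempty → (∀ u ∈ T, ∀ w, G.Adj u w → w ∈ T) → 3 ≤ T.card := by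
    rintro T ⟨u, hu⟩ hT
    have hs : insert u (nb G u) ⊆ T :=
      Finset.insert_subset hu fun w hw => hT u hu w (mem_nb.1 hw)
    have := Finset.card_le_card hs
    rw [Finset.card_insert_of_notMem (by simp)] at this
    have := hdeg u
    omega
  have hreach : ∀ w, G.Reachable v w → w ∈ A := by
    rintro w ⟨p⟩
    induction p with
    | nil => exact hv
    | cons h p ih => exact ih (hcl' _ hv _ h)
  have hc := hcomp (G.connectedComponentMk v)
  have hsupp : (G.connectedComponentMk v).supp = ↑(A.filter (G.Reachable v)) := by
    ext w
    simp only [ConnectedComponent.mem_supp_iff, ConnectedComponent.eq, Finset.coe_filter,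
      Set.mem_ofPred_eq]
    exact ⟨fun h => ⟨hreach w h.symm, h.symm⟩, fun h => h.2.symm⟩
  rw [hsupp, Set.ncard_coe_finset] at hc
  have hsum := Finset.card_filter_add_card_filter_not (s := A) (G.Reachable v)
  have h1 := three (A.filter (G.Reachable v)) ⟨v, by simp [hv]⟩ (by
    intro u hu w huw
    rw [Finset.mem_filter] at hu ⊢
    exact ⟨hcl' u hu.1 w huw, hu.2.trans huw.reachable⟩)
  have h2 := three (A.filter (fun w => ¬ G.Reachable v w)) (Finset.card_pos.1 (by omega)) (by
    intro u hu w huw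
    rw [Finset.mem_filter] at hu ⊢
    exact ⟨hcl' u hu.1 w huw, fun h => hu.2 (h.trans huw.symm.reachable)⟩)
  omega

theorem le_lambdaNum {G : SimpleGraph V} {k : ℕ} (h : Packs G Finset.univ k) :
    k ≤ lambdaNum G := by
  obtain ⟨P, hP, hk, -⟩ := h
  refine le_csSup ⟨Fintype.card (V × V × V), ?_⟩ ⟨P, hP, hk⟩
  rintro n ⟨Q, -, rfl⟩
  exact Finset.card_le_univ Q

end Graph

/-- If every vertex of `G` has degree 2 or 3 and no connected component of `G` has
exactly 5 vertices, then `λ(G) ≥ ⌈v(G)/4⌉`. -/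
theorem stmt1 {V : Type*} [Fintype V] (G : SimpleGraph V)
    (hdeg : ∀ v, (G.neighborSet v).ncard = 2 ∨ (G.neighborSet v).ncard = 3)
    (hcomp : ∀ c : G.ConnectedComponent, c.supp.ncard ≠ 5) :
    (Fintype.card V + 3) / 4 ≤ lambdaNum G := by
  classical
  have hdeg' : ∀ v, (nb G v).card = 2 ∨ (nb G v).card = 3 := fun v => by
    rw [nb, ← Set.ncard_eq_toFinset_card]
    exact hdeg v
  obtain ⟨k, hk, hc⟩ := (good_of_components hdeg' hcomp).exists_packs
  have hall : posVerts G = Finset.univ := by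
    ext v
    have := hdeg' v
    simp only [mem_posVerts, Finset.mem_univ, iff_true]
    omega
  rw [hall, Finset.card_univ] at hc
  have := le_lambdaNum hk
  omega
end
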